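/- arXiv:1111.3076 — 2 statements merged into one kernel-verified Lean document; each statement's English description precedes it below -/
import Mathlib

section
/- A CAT(0) regular simplicial 3-complex contains no empty triangles, no empty squares, and no empty pentagons. -/
open scoped Classical

noncomputable section

/-! ## Abstract simplicial complexes and their piecewise Euclidean geometry

An (abstract, regular) simplicial complex on a vertex type `V` is a collection of nonempty
finite vertex sets (its simplices), closed under passage to nonempty subsets.  It is regarded
as a *regular* piecewise Euclidean complex: every `n`-simplex is isometric to the regular
Euclidean `n`-simplex with unit edge lengths, glued along faces by isometries.  This geometry
is built into the intrinsic metric on the geometric realization defined below. -/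

structure SC (V : Type*) where
  faces : Set (Finset V)
  not_mem_empty : ∅ ∉ faces
  down : ∀ s ∈ faces, ∀ t : Finset V, t ⊆ s → t ≠ ∅ → t ∈ faces

variable {V : Type*} [DecidableEq V]

/-- The complex has dimension at most `3` (every simplex has at most 4 vertices). -/
def SC.Is3Dim (K : SC V) : Prop := ∀ s ∈ K.faces, s.card ≤ 4

/-- A point of the geometric realization of `K`, in barycentric coordinates. -/
def SC.IsPoint (K : SC V) (x : V →₀ ℝ) : Prop :=
  (∀ v, 0 ≤ x v) ∧ (x.sum fun _ r => r) = 1 ∧ x.support ∈ K.faces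

/-- Two realization points lie in a common closed simplex of `K`. -/
def SC.SameCell (K : SC V) (x y : V →₀ ℝ) : Prop := x.support ∪ y.support ∈ K.faces

/-- The Euclidean distance between two points of a common *regular unit-edge* simplex, in
barycentric coordinates: realizing the vertices as `eᵥ/√2` in `ℓ²(V)` gives a regular simplex
with unit edge lengths, and the induced distance is `√(∑ (xᵥ - yᵥ)² / 2)`. -/
def stepD (x y : V →₀ ℝ) : ℝ := Real.sqrt (((x - y).sum fun _ r => r ^ 2) / 2)

/-- A chain of realization points in which consecutive points share a simplex. -/
def SC.IsChain (K : SC V) (c : List (V →₀ ℝ)) : Prop :=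
  (∀ z ∈ c, K.IsPoint z) ∧ c.Chain' K.SameCell

/-- The length of a chain of realization points. -/
def chLen (c : List (V →₀ ℝ)) : ℝ := ((c.zip c.tail).map fun p => stepD p.1 p.2).sum

/-- The intrinsic (length) metric of the regular piecewise Euclidean complex `K`:
the infimum of lengths of piecewise linear chains joining two realization points. -/
def SC.pdist (K : SC V) (x y : V →₀ ℝ) : ℝ :=
  sInf {L | ∃ c, K.IsChain c ∧ c.head? = some x ∧ c.getLast? = some y ∧ chLen c = L}

/-- `K` is CAT(0): its geometric realization with the intrinsic piecewise Euclidean metric is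
chain-connected, midpoints exist (so the metric is geodesic), and every midpoint satisfies the
Bruhat–Tits CN comparison inequality.  For geodesic spaces this is the standard comparison
formulation of the CAT(0) condition, which (by the Cartan–Hadamard theorem and Gromov's link
condition) is equivalent to: connected, simply connected, and no metric link contains a
locally geodesic loop of length less than `2 * π`. -/
def SC.IsCAT0 (K : SC V) : Prop :=
  K.faces.Nonempty ∧
  (∀ x y, K.IsPoint x → K.IsPoint y →
    ∃ c, K.IsChain c ∧ c.head? = some x ∧ c.getLast? = some y) ∧
  (∀ x y, K.IsPoint x → K.IsPoint y →
    ∃ m, K.IsPoint m ∧ K.pdist x m = K.pdist x y / 2 ∧ K.pdist m y = K.pdist x y / 2) ∧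
  (∀ x y z m, K.IsPoint x → K.IsPoint y → K.IsPoint z → K.IsPoint m →
    K.pdist y m = K.pdist y z / 2 → K.pdist m z = K.pdist y z / 2 →
    K.pdist x m ^ 2 ≤ K.pdist x y ^ 2 / 2 + K.pdist x z ^ 2 / 2 - K.pdist y z ^ 2 / 4)

/-- Adjacency of vertices in the 1-skeleton of `K`. -/
def SC.adj (K : SC V) (u v : V) : Prop := u ≠ v ∧ ({u, v} : Finset V) ∈ K.faces

/-! ## Combinatorial paths -/

/-- A combinatorial edge path with respect to an adjacency relation `E`: an eventually
constant function `ℕ → V` traversing an edge at each time `i < len`.  (Equivalently, an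
alternating sequence `[v₀, e₁, v₁, …, e_n, v_n]` of vertices and edges with `eᵢ` spanned by
`{v_{i-1}, v_i}`; its parameterization is constant after time `len`.) -/
structure EPath {V : Type*} (E : V → V → Prop) where
  f : ℕ → V
  len : ℕ
  step : ∀ i, i < len → E (f i) (f (i + 1))
  stable : ∀ i, len ≤ i → f i = f len

namespace EPath

variable {E : V → V → Prop}

/-- The starting vertex. -/
def src (p : EPath E) : V := p.f 0

/-- The ending vertex. -/
def dst (p : EPath E) : V := p.f p.len

/-- A combinatorial loop. -/
def Closed (p : EPath E) : Prop := p.dst = p.src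

/-- A path is tight if it does not cross the same (unordered) edge twice. -/
def Tight (p : EPath E) : Prop :=
  ∀ i j, i < p.len → j < p.len →
    ({p.f i, p.f (i + 1)} : Finset V) = ({p.f j, p.f (j + 1)} : Finset V) → i = j

/-- The word of vertices read by a path. -/
def word (p : EPath E) : List V := (List.range (p.len + 1)).map p.f

end EPath

/-- The combinatorial distance between two vertices: the least length of an edge path. -/
def SC.cd (K : SC V) (u v : V) : ℕ :=
  sInf {n | ∃ p : EPath K.adj, p.src = u ∧ p.dst = v ∧ p.len = n}

/-- A combinatorial geodesic: a path of minimal length between its endpoints. -/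
def SC.IsGeo (K : SC V) (p : EPath K.adj) : Prop := p.len = K.cd p.src p.dst

/-! ## Basic moves on combinatorial paths -/

/-- A trivial move: delete a backtracking subpath `a, b, a`, replacing it by `a`. -/
def TrivMove (K : SC V) (p q : EPath K.adj) : Prop :=
  ∃ i, i + 2 ≤ p.len ∧ p.f (i + 2) = p.f i ∧ q.len + 2 = p.len ∧
    (∀ j, j ≤ i → q.f j = p.f j) ∧ ∀ j, i ≤ j → j ≤ q.len → q.f j = p.f (j + 2)

/-- A triangle move: replace two sides `a, b, c` of a triangle of `K` by the third side `a, c`. -/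
def TriMove (K : SC V) (p q : EPath K.adj) : Prop :=
  ∃ i, i + 2 ≤ p.len ∧
    ({p.f i, p.f (i + 1), p.f (i + 2)} : Finset V) ∈ K.faces ∧
    ({p.f i, p.f (i + 1), p.f (i + 2)} : Finset V).card = 3 ∧
    q.len + 1 = p.len ∧
    (∀ j, j ≤ i → q.f j = p.f j) ∧ ∀ j, i < j → j ≤ q.len → q.f j = p.f (j + 1)

/-- A triangle-triangle move: across two triangles `{a, b, x}` and `{b, x, c}` of `K` sharing
the edge `{b, x}`, replace the arc `a, b, c` by the arc `a, x, c` (where `a, c` are the two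
opposite degree-two vertices of the doubly based disk). -/
def TTMove (K : SC V) (p q : EPath K.adj) : Prop :=
  ∃ i x, 0 < i ∧ i < p.len ∧ q.len = p.len ∧ q.f i = x ∧ (∀ j, j ≠ i → q.f j = p.f j) ∧
    x ≠ p.f i ∧ p.f (i - 1) ≠ p.f (i + 1) ∧
    ({p.f (i - 1), p.f i, x} : Finset V) ∈ K.faces ∧
    ({p.f (i - 1), p.f i, x} : Finset V).card = 3 ∧
    ({p.f i, x, p.f (i + 1)} : Finset V) ∈ K.faces ∧
    ({p.f i, x, p.f (i + 1)} : Finset V).card = 3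

/-- A basic move: a trivial move, a triangle move, or a triangle-triangle move.  Trivial and
triangle moves are length-reducing; triangle-triangle moves are length-preserving. -/
def BasicMove (K : SC V) (p q : EPath K.adj) : Prop :=
  TrivMove K p q ∨ TriMove K p q ∨ TTMove K p q

/-! ## Disk diagrams -/

/-- Points of the Euclidean plane. -/
abbrev Pt2 : Type := ℝ × ℝ

/-- A simplicial disk diagram: a finite 2-complex embedded in the Euclidean plane `ℝ²`
(vertices are points, edges are straight segments, 2-cells are nondegenerate triangles, and
any two cells meet in the realization of their common face), whose support (the union of its
cells) is contractible. -/
structure SimpDisk where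
  verts : Finset Pt2
  edges : Finset (Finset Pt2)
  facesD : Finset (Finset Pt2)
  verts_nonempty : verts.Nonempty
  edge_card : ∀ e ∈ edges, e.card = 2
  edge_sub : ∀ e ∈ edges, e ⊆ verts
  face_card : ∀ t ∈ facesD, t.card = 3
  face_sub : ∀ t ∈ facesD, t ⊆ verts
  face_edges : ∀ t ∈ facesD, ∀ e : Finset Pt2, e ⊆ t → e.card = 2 → e ∈ edges
  face_nondegen : ∀ t ∈ facesD, ¬ Collinear ℝ (t : Set Pt2)
  glue : ∀ s ∈ verts.image (fun v => ({v} : Finset Pt2)) ∪ edges ∪ facesD,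
         ∀ t ∈ verts.image (fun v => ({v} : Finset Pt2)) ∪ edges ∪ facesD,
      convexHull ℝ (s : Set Pt2) ∩ convexHull ℝ (t : Set Pt2) =
        convexHull ℝ ((s ∩ t : Finset Pt2) : Set Pt2)
  contractible : ContractibleSpace
    (⋃ s ∈ (verts.image (fun v => ({v} : Finset Pt2)) ∪ edges ∪ facesD : Finset (Finset Pt2)),
      convexHull ℝ (s : Set Pt2))

namespace SimpDisk

/-- The cells of a disk diagram. -/
def cells (D : SimpDisk) : Finset (Finset Pt2) :=
  D.verts.image (fun v => ({v} : Finset Pt2)) ∪ D.edges ∪ D.facesD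

/-- The support of a disk diagram: the union of its closed cells in the plane. -/
def supp (D : SimpDisk) : Set Pt2 := ⋃ s ∈ D.cells, convexHull ℝ (s : Set Pt2)

/-- A disk diagram is nonsingular if it is homeomorphic to the closed unit disk;
otherwise it is singular (it has a cut point). -/
def Nonsingular (D : SimpDisk) : Prop :=
  Nonempty (D.supp ≃ₜ (Metric.closedBall (0 : Pt2) 1 : Set Pt2))

/-- The degree of a vertex: the number of edges of `D` incident to it. -/
def deg (D : SimpDisk) (v : Pt2) : ℕ := (D.edges.filter fun e => v ∈ e).card

/-- A boundary vertex of a disk diagram. -/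
def BVert (D : SimpDisk) (v : Pt2) : Prop := v ∈ D.verts ∧ v ∈ frontier D.supp

/-- An interior vertex of a disk diagram. -/
def IVert (D : SimpDisk) (v : Pt2) : Prop := v ∈ D.verts ∧ v ∈ interior D.supp

/-- A boundary edge of a disk diagram. -/
def BEdge (D : SimpDisk) (e : Finset Pt2) : Prop :=
  e ∈ D.edges ∧ convexHull ℝ (e : Set Pt2) ⊆ frontier D.supp

/-- Adjacency in the 1-skeleton of a disk diagram. -/
def adj (D : SimpDisk) (a b : Pt2) : Prop := a ≠ b ∧ ({a, b} : Finset Pt2) ∈ D.edges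

/-- The combinatorial area of a simplicial disk: the number of its triangles. -/
def area (D : SimpDisk) : ℕ := D.facesD.card

/-- The boundary cycle of a disk diagram: a closed edge path traversing exactly the
boundary edges of `D`. -/
def IsBoundaryCycle (D : SimpDisk) (c : EPath D.adj) : Prop :=
  c.Closed ∧ (∀ i, i < c.len → D.BEdge {c.f i, c.f (i + 1)}) ∧
  (∀ e : Finset Pt2, D.BEdge e → ∃ i, i < c.len ∧ e = {c.f i, c.f (i + 1)}) ∧
  (∀ v, D.BVert v → ∃ i, i ≤ c.len ∧ c.f i = v)

end SimpDisk

/-- A disk diagram spanning the combinatorial loop `α` in the complex `K`: a simplicial disk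
`D` together with a simplicial map `D → K` whose restriction to the boundary cycle of `D`
is `α`. -/
structure SpanningDisk (K : SC V) (α : EPath K.adj) where
  D : SimpDisk
  fmap : Pt2 → V
  cellmap : ∀ s ∈ D.cells, s.image fmap ∈ K.faces
  bc : EPath D.adj
  bc_is : D.IsBoundaryCycle bc
  bc_len : bc.len = α.len
  bc_map : ∀ i, fmap (bc.f i) = α.f i

/-- A spanning disk of minimal combinatorial area among the disks spanning the same loop. -/
def SpanningDisk.IsMinimal {K : SC V} {α : EPath K.adj} (S : SpanningDisk K α) : Prop :=
  ∀ S' : SpanningDisk K α, S.D.area ≤ S'.D.area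

/-- An empty `n`-gon: a tight combinatorial loop of length `n` all of whose minimal spanning
disks have an interior vertex. -/
def SC.IsEmptyNgon (K : SC V) (α : EPath K.adj) (n : ℕ) : Prop :=
  α.Closed ∧ α.Tight ∧ α.len = n ∧
  ∀ S : SpanningDisk K α, S.IsMinimal → ∃ v : Pt2, S.D.IVert v

/-! ## Flagness, fullness, links -/

/-- A complex is flag if every nonempty finite set of vertices pairwise joined by edges
spans a simplex. -/
def SC.IsFlag (K : SC V) : Prop :=
  ∀ s : Finset V, s.Nonempty → (∀ v ∈ s, ({v} : Finset V) ∈ K.faces) →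
    (∀ u ∈ s, ∀ w ∈ s, u ≠ w → ({u, w} : Finset V) ∈ K.faces) → s ∈ K.faces

/-- `L` is a full subcomplex of `K`: a subcomplex containing every simplex of `K` whose
vertices all lie in `L`. -/
def SC.FullIn (L K : SC V) : Prop :=
  L.faces ⊆ K.faces ∧ ∀ s ∈ K.faces, (∀ v ∈ s, ({v} : Finset V) ∈ L.faces) → s ∈ L.faces

/-- The (metric) link of a vertex `v` of `K`, described combinatorially: its simplices
correspond to the simplices `t` of `K` with `insert v t` a simplex of `K` (a vertex of the
link corresponds to an edge of `K` incident to `v`, i.e. to its unit tangent direction). -/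
def SC.link (K : SC V) (v : V) : SC V where
  faces := {t | t ∈ K.faces ∧ v ∉ t ∧ insert v t ∈ K.faces}
  not_mem_empty := fun h => K.not_mem_empty h.1
  down := by
    rintro s ⟨hs, hvs, hins⟩ t hts htne
    refine ⟨K.down s hs t hts htne, fun hvt => hvs (hts hvt), ?_⟩
    refine K.down _ hins _ (Finset.insert_subset_insert v hts) ?_
    simp

/-- The combinatorial link of a simplex `σ` of `K`: the union of all simplices `t` such that
`t ∗ σ = t ∪ σ` is a simplex of `K`. -/
def SC.clink (K : SC V) (σ : Finset V) : SC V where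
  faces := {t | t ∈ K.faces ∧ Disjoint t σ ∧ t ∪ σ ∈ K.faces}
  not_mem_empty := fun h => K.not_mem_empty h.1
  down := by
    rintro s ⟨hs, hdisj, huni⟩ t hts htne
    refine ⟨K.down s hs t hts htne, hdisj.mono_left hts, ?_⟩
    refine K.down _ huni _ (Finset.union_subset_union hts (subset_refl σ)) ?_
    intro h
    exact htne (Finset.union_eq_empty.mp h).1

/-- A complex is `k`-large if it is flag and contains no empty `n`-gons for `n < k`. -/
def SC.IsKLarge (K : SC V) (k : ℕ) : Prop :=
  K.IsFlag ∧ ∀ (α : EPath K.adj) (n : ℕ), n < k → ¬ K.IsEmptyNgon α n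

/-- A complex is systolic (satisfies simplicial nonpositive curvature) if the combinatorial
link of every simplex is 6-large. -/
def SC.IsSystolic (K : SC V) : Prop := ∀ σ ∈ K.faces, (K.clink σ).IsKLarge 6

/-! ## Gersten–Short geodesics -/

/-- The diagonal condition for a path lifted along the boundary of a disk `D` via `c` at
offset `o`, of length `n`: whenever the `j`-th vertex is positive (`4 - deg > 0`), the
`(j-1)`-st vertex is negative (`4 - deg < 0`), for `1 ≤ j ≤ n - 1`. -/
def DiagCondAt (D : SimpDisk) (c : ℕ → Pt2) (o n : ℕ) : Prop :=
  ∀ j, 0 < j → j < n → D.deg (c (o + j)) < 4 → 4 < D.deg (c (o + j - 1))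

/-- A Gersten–Short geodesic: a combinatorial geodesic satisfying the diagonal condition
along every minimal (possibly singular) spanning disk having it along its boundary. -/
def IsGS (K : SC V) (γ : EPath K.adj) : Prop :=
  K.IsGeo γ ∧
  ∀ (β : EPath K.adj), β.Closed →
    ∀ S : SpanningDisk K β, S.IsMinimal →
      ∀ o : ℕ, o + γ.len ≤ S.bc.len →
        (∀ j, j ≤ γ.len → S.fmap (S.bc.f (o + j)) = γ.f j) →
          DiagCondAt S.D S.bc.f o γ.len

/-! ## Finite state automata and regular path systems -/

/-- A finite state automaton over the alphabet `A`: a finite labeled directed graph with a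
distinguished start vertex and a set of accept vertices. -/
structure FSA (A : Type*) where
  n : ℕ
  start : Fin n
  accept : Finset (Fin n)
  trans : Set (Fin n × A × Fin n)
  trans_finite : trans.Finite

/-- A word is accepted by an FSA if it labels a directed path from the start vertex to an
accept vertex. -/
def FSA.Accepts {A : Type*} (M : FSA A) (w : List A) : Prop :=
  ∃ q : ℕ → Fin M.n, q 0 = M.start ∧ q w.length ∈ M.accept ∧
    ∀ (i : ℕ) (h : i < w.length), (q i, w.get ⟨i, h⟩, q (i + 1)) ∈ M.trans

/-- A path system is regular if the set of its vertex words is the language accepted by some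
finite state automaton. -/
def RegularSystem {E : V → V → Prop} (P : Set (EPath E)) : Prop :=
  ∃ M : FSA V, ∀ w : List V, M.Accepts w ↔ ∃ p ∈ P, p.word = w

/-- `U` is the union of the disk diagrams `D1` and `D2` glued exactly along the combinatorial
path read by `c1` (resp. `c2`) at offset `o1` (resp. `o2`) for `n` steps. -/
def IsUnionAlong (U D1 D2 : SimpDisk) (c1 c2 : ℕ → Pt2) (o1 o2 n : ℕ) : Prop :=
  U.verts = D1.verts ∪ D2.verts ∧
  U.edges = D1.edges ∪ D2.edges ∧
  U.facesD = D1.facesD ∪ D2.facesD ∧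
  (∀ j, j ≤ n → c1 (o1 + j) = c2 (o2 + j)) ∧
  D1.verts ∩ D2.verts = (Finset.range (n + 1)).image (fun j => c1 (o1 + j)) ∧
  D1.edges ∩ D2.edges =
    (Finset.range n).image (fun j => ({c1 (o1 + j), c1 (o1 + j + 1)} : Finset Pt2)) ∧
  D1.facesD ∩ D2.facesD = ∅

end

/-! ## Metric part -/

section MetricPart

set_option linter.unusedSectionVars false
set_option linter.unusedSimpArgs false

variable {V : Type*} [DecidableEq V]

theorem le_of_sq_le_sq_cg {a b : ℝ} (h : a ^ 2 ≤ b ^ 2) (hb : 0 ≤ b) : a ≤ b :=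
  (le_abs_self a).trans (abs_le_of_sq_le_sq h hb)

theorem cg_stepD_sq (x y : V →₀ ℝ) (S : Finset V) (hx : x.support ⊆ S) (hy : y.support ⊆ S) :
    stepD x y ^ 2 = (∑ v ∈ S, (x v - y v) ^ 2) / 2 := by
  have h1 : ((x - y).sum fun _ r => r ^ 2) = ∑ v ∈ S, (x v - y v) ^ 2 := by
    rw [Finsupp.sum_of_support_subset (s := S)]
    · simp
    · intro v hv
      by_contra hvS
      have h1 : x v = 0 := by
        by_contra h; exact hvS (hx (Finsupp.mem_support_iff.2 h))
      have h2 : y v = 0 := by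
        by_contra h; exact hvS (hy (Finsupp.mem_support_iff.2 h))
      simp [h1, h2] at hv
    · simp
  unfold stepD
  rw [Real.sq_sqrt, h1]
  rw [h1]
  exact div_nonneg (Finset.sum_nonneg fun _ _ => sq_nonneg _) (by norm_num)

theorem cg_stepD_nonneg (x y : V →₀ ℝ) : 0 ≤ stepD x y := Real.sqrt_nonneg _

theorem cg_stepD_self (x : V →₀ ℝ) : stepD x x = 0 := by simp [stepD]

theorem cg_stepD_comm (x y : V →₀ ℝ) : stepD x y = stepD y x := by
  have h1 := cg_stepD_sq x y (x.support ∪ y.support) Finset.subset_union_left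
    Finset.subset_union_right
  have h2 := cg_stepD_sq y x (x.support ∪ y.support) Finset.subset_union_right
    Finset.subset_union_left
  have : stepD x y ^ 2 = stepD y x ^ 2 := by
    rw [h1, h2]; congr 1; exact Finset.sum_congr rfl fun v _ => by ring
  exact (sq_eq_sq₀ (cg_stepD_nonneg _ _) (cg_stepD_nonneg _ _)).1 this

theorem cg_stepD_triangle (x y z : V →₀ ℝ) : stepD x z ≤ stepD x y + stepD y z := by
  set S := x.support ∪ y.support ∪ z.support with hS
  have hx : x.support ⊆ S := by
    intro v hv; simp only [hS, Finset.mem_union]; tauto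
  have hy : y.support ⊆ S := by
    intro v hv; simp only [hS, Finset.mem_union]; tauto
  have hz : z.support ⊆ S := by
    intro v hv; simp only [hS, Finset.mem_union]; tauto
  have h1 := cg_stepD_sq x y S hx hy
  have h2 := cg_stepD_sq y z S hy hz
  have h3 := cg_stepD_sq x z S hx hz
  have hcs := Finset.sum_mul_sq_le_sq_mul_sq S (fun v => x v - y v) (fun v => y v - z v)
  have hsum : ∑ v ∈ S, (x v - z v) ^ 2 = ∑ v ∈ S, (x v - y v) ^ 2 + ∑ v ∈ S, (y v - z v) ^ 2
      + 2 * ∑ v ∈ S, (x v - y v) * (y v - z v) := by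
    rw [Finset.mul_sum, ← Finset.sum_add_distrib, ← Finset.sum_add_distrib]
    exact Finset.sum_congr rfl fun v _ => by ring
  have ha := cg_stepD_nonneg x y
  have hb := cg_stepD_nonneg y z
  refine le_of_sq_le_sq_cg ?_ (by positivity)
  set P := ∑ v ∈ S, (x v - y v) * (y v - z v)
  have hP : P ≤ 2 * (stepD x y * stepD y z) := by
    refine le_of_sq_le_sq_cg ?_ (by positivity)
    calc P ^ 2 ≤ _ := hcs
      _ = (2 * (stepD x y * stepD y z)) ^ 2 := by
        have e1 : ∑ v ∈ S, (x v - y v) ^ 2 = 2 * stepD x y ^ 2 := by rw [h1]; ring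
        have e2 : ∑ v ∈ S, (y v - z v) ^ 2 = 2 * stepD y z ^ 2 := by rw [h2]; ring
        rw [e1, e2]; ring
  nlinarith

theorem cg_chLen_cons (x y : V →₀ ℝ) (l : List (V →₀ ℝ)) :
    chLen (x :: y :: l) = stepD x y + chLen (y :: l) := by
  simp [chLen]

theorem cg_chLen_single (x : V →₀ ℝ) : chLen [x] = 0 := by simp [chLen]

theorem cg_chain_tail {K : SC V} {x y : V →₀ ℝ} {l : List (V →₀ ℝ)}
    (h : K.IsChain (x :: y :: l)) :
    K.IsPoint x ∧ K.IsPoint y ∧ K.SameCell x y ∧ K.IsChain (y :: l) := by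
  obtain ⟨h1, h2⟩ := h
  refine ⟨h1 x (by simp), h1 y (by simp), ?_, fun z hz => h1 z (by simp_all), ?_⟩
  · exact (List.isChain_cons_cons.1 h2).1
  · exact (List.isChain_cons_cons.1 h2).2

/-- A pseudo-distance dominated by the step distance on cells is dominated by chain lengths. -/
theorem cg_le_chLen (K : SC V) (ρ : (V →₀ ℝ) → (V →₀ ℝ) → ℝ) (h0 : ∀ x, ρ x x ≤ 0)
    (ht : ∀ x y z, ρ x z ≤ ρ x y + ρ y z)
    (hs : ∀ x y, K.IsPoint x → K.IsPoint y → K.SameCell x y → ρ x y ≤ stepD x y) :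
    ∀ (c : List (V →₀ ℝ)) (x y : V →₀ ℝ), K.IsChain c → c.head? = some x →
      c.getLast? = some y → ρ x y ≤ chLen c := by
  intro c
  induction c with
  | nil => intro x y _ h; simp at h
  | cons a l ih =>
    intro x y hc hx hy
    simp only [List.head?_cons, Option.some.injEq] at hx
    subst hx
    cases l with
    | nil =>
      simp at hy
      subst hy
      rw [cg_chLen_single]; exact h0 _
    | cons b l =>
      obtain ⟨h1, h2, h3, h4⟩ := cg_chain_tail hc
      have := ih b y h4 (by simp) (by simpa [List.getLast?_cons_cons] using hy)
      rw [cg_chLen_cons]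
      linarith [hs a b h1 h2 h3, ht a b y]

theorem cg_chLen_nonneg (c : List (V →₀ ℝ)) : 0 ≤ chLen c := by
  unfold chLen
  apply List.sum_nonneg
  intro r hr
  simp only [List.mem_map] at hr
  obtain ⟨p, _, rfl⟩ := hr
  exact cg_stepD_nonneg _ _

theorem cg_bdd (K : SC V) (x y : V →₀ ℝ) : BddBelow
    {L | ∃ c, K.IsChain c ∧ c.head? = some x ∧ c.getLast? = some y ∧ chLen c = L} :=
  ⟨0, by rintro L ⟨c, _, _, _, rfl⟩; exact cg_chLen_nonneg c⟩

theorem cg_pdist_nonneg (K : SC V) (x y : V →₀ ℝ) : 0 ≤ K.pdist x y := by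
  apply Real.sInf_nonneg
  rintro L ⟨c, _, _, _, rfl⟩; exact cg_chLen_nonneg c

theorem cg_pdist_le (K : SC V) {x y : V →₀ ℝ} (hx : K.IsPoint x) (hy : K.IsPoint y)
    (h : K.SameCell x y) : K.pdist x y ≤ stepD x y := by
  apply csInf_le (cg_bdd K x y)
  refine ⟨[x, y], ⟨?_, ?_⟩, by simp, by simp, by simp [chLen]⟩
  · intro z hz
    simp at hz
    rcases hz with rfl | rfl <;> assumption
  · show List.IsChain K.SameCell [x, y]
    simpa using h

theorem cg_ne {K : SC V} (hK : K.IsCAT0) {x y : V →₀ ℝ} (hx : K.IsPoint x) (hy : K.IsPoint y) :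
    Set.Nonempty
    {L | ∃ c, K.IsChain c ∧ c.head? = some x ∧ c.getLast? = some y ∧ chLen c = L} := by
  obtain ⟨c, hc⟩ := hK.2.1 x y hx hy
  exact ⟨chLen c, c, hc.1, hc.2.1, hc.2.2, rfl⟩

theorem cg_le_pdist {K : SC V} (hK : K.IsCAT0) (ρ : (V →₀ ℝ) → (V →₀ ℝ) → ℝ)
    (h0 : ∀ x, ρ x x ≤ 0) (ht : ∀ x y z, ρ x z ≤ ρ x y + ρ y z)
    (hs : ∀ x y, K.IsPoint x → K.IsPoint y → K.SameCell x y → ρ x y ≤ stepD x y)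
    {x y : V →₀ ℝ} (hx : K.IsPoint x) (hy : K.IsPoint y) : ρ x y ≤ K.pdist x y := by
  apply le_csInf (cg_ne hK hx hy)
  rintro L ⟨c, h1, h2, h3, rfl⟩
  exact cg_le_chLen K ρ h0 ht hs c x y h1 h2 h3

theorem cg_stepD_le_pdist {K : SC V} (hK : K.IsCAT0)
    {x y : V →₀ ℝ} (hx : K.IsPoint x) (hy : K.IsPoint y) : stepD x y ≤ K.pdist x y :=
  cg_le_pdist hK stepD (fun x => (cg_stepD_self x).le) cg_stepD_triangle
    (fun _ _ _ _ _ => le_rfl) hx hy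

theorem cg_pdist_eq {K : SC V} (hK : K.IsCAT0) {x y : V →₀ ℝ} (hx : K.IsPoint x)
    (hy : K.IsPoint y) (h : K.SameCell x y) : K.pdist x y = stepD x y :=
  le_antisymm (cg_pdist_le K hx hy h) (cg_stepD_le_pdist hK hx hy)

/-- Prepending chains: the length of a chain bounds the increase of the distance. -/
theorem cg_pdist_chain_add {K : SC V} (hK : K.IsCAT0) {z : V →₀ ℝ} (hz : K.IsPoint z) :
    ∀ (c : List (V →₀ ℝ)) (x y : V →₀ ℝ), K.IsChain c → c.head? = some x →
      c.getLast? = some y → K.pdist x z ≤ chLen c + K.pdist y z := by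
  intro c
  induction c with
  | nil => intro x y _ h; simp at h
  | cons a l ih =>
    intro x y hc hx hy
    simp only [List.head?_cons, Option.some.injEq] at hx
    subst hx
    cases l with
    | nil =>
      simp at hy
      subst hy
      rw [cg_chLen_single]; simp
    | cons b l =>
      obtain ⟨h1, h2, h3, h4⟩ := cg_chain_tail hc
      have := ih b y h4 (by simp) (by simpa [List.getLast?_cons_cons] using hy)
      rw [cg_chLen_cons]
      suffices K.pdist a z - stepD a b ≤ K.pdist b z by linarith
      apply le_csInf (cg_ne hK h2 hz)
      rintro L ⟨c, k1, k2, k3, rfl⟩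
      suffices K.pdist a z ≤ stepD a b + chLen c by linarith
      apply csInf_le (cg_bdd K a z)
      cases c with
      | nil => simp at k2
      | cons b' l' =>
        simp only [List.head?_cons, Option.some.injEq] at k2
        subst k2
        refine ⟨a :: b' :: l', ⟨?_, ?_⟩, by simp, ?_, cg_chLen_cons _ _ _⟩
        · intro w hw
          rcases List.mem_cons.1 hw with rfl | hw
          · exact h1
          · exact k1.1 w hw
        · exact List.isChain_cons_cons.2 ⟨h3, k1.2⟩
        · simpa [List.getLast?_cons_cons] using k3

theorem cg_pdist_triangle {K : SC V} (hK : K.IsCAT0) {x y z : V →₀ ℝ} (hx : K.IsPoint x)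
    (hy : K.IsPoint y) (hz : K.IsPoint z) : K.pdist x z ≤ K.pdist x y + K.pdist y z := by
  suffices K.pdist x z - K.pdist y z ≤ K.pdist x y by linarith
  apply le_csInf (cg_ne hK hx hy)
  rintro L ⟨c, k1, k2, k3, rfl⟩
  linarith [cg_pdist_chain_add hK hz c x y k1 k2 k3]

theorem cg_pdist_self {K : SC V} {x : V →₀ ℝ} (hx : K.IsPoint x) : K.pdist x x = 0 := by
  apply le_antisymm _ (cg_pdist_nonneg K x x)
  apply csInf_le (cg_bdd K x x)
  exact ⟨[x], ⟨by simpa using hx, List.isChain_singleton _⟩, by simp, by simp, cg_chLen_single x⟩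

theorem cg_sameCell_symm {K : SC V} {x y : V →₀ ℝ} (h : K.SameCell x y) : K.SameCell y x := by
  unfold SC.SameCell at *; rwa [Finset.union_comm]

theorem cg_pdist_chain_rev {K : SC V} (hK : K.IsCAT0) :
    ∀ (c : List (V →₀ ℝ)) (x y : V →₀ ℝ), K.IsPoint y → K.IsChain c → c.head? = some x →
      c.getLast? = some y → K.pdist y x ≤ chLen c := by
  intro c
  induction c with
  | nil => intro x y _ _ h; simp at h
  | cons a l ih =>
    intro x y hyp hc hx hy
    simp only [List.head?_cons, Option.some.injEq] at hx
    subst hx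
    cases l with
    | nil =>
      simp at hy
      subst hy
      rw [cg_chLen_single, cg_pdist_self hyp]
    | cons b l =>
      obtain ⟨h1, h2, h3, h4⟩ := cg_chain_tail hc
      have := ih b y hyp h4 (by simp) (by simpa [List.getLast?_cons_cons] using hy)
      rw [cg_chLen_cons]
      have t1 := cg_pdist_triangle hK hyp h2 h1
      have t2 := cg_pdist_le K h2 h1 (cg_sameCell_symm h3)
      rw [cg_stepD_comm] at t2
      linarith

theorem cg_pdist_comm_le {K : SC V} (hK : K.IsCAT0) {x y : V →₀ ℝ} (hx : K.IsPoint x)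
    (hy : K.IsPoint y) : K.pdist y x ≤ K.pdist x y := by
  apply le_csInf (cg_ne hK hx hy)
  rintro L ⟨c, k1, k2, k3, rfl⟩
  exact cg_pdist_chain_rev hK c x y hy k1 k2 k3

theorem cg_pdist_comm {K : SC V} (hK : K.IsCAT0) {x y : V →₀ ℝ} (hx : K.IsPoint x)
    (hy : K.IsPoint y) : K.pdist x y = K.pdist y x :=
  le_antisymm (cg_pdist_comm_le hK hy hx) (cg_pdist_comm_le hK hx hy)

/-- The realization point of a vertex. -/
noncomputable def cgPt (v : V) : V →₀ ℝ := Finsupp.single v 1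

theorem cg_support_pt (v : V) : (cgPt v).support = {v} := by
  unfold cgPt; exact Finsupp.support_single_ne_zero v one_ne_zero

theorem cg_isPoint_pt {K : SC V} {v : V} (h : ({v} : Finset V) ∈ K.faces) :
    K.IsPoint (cgPt v) := by
  refine ⟨fun w => ?_, ?_, by rw [cg_support_pt]; exact h⟩
  · unfold cgPt; rw [Finsupp.single_apply]; split_ifs <;> norm_num
  · unfold cgPt; simp

theorem cg_adj_vert {K : SC V} {u v : V} (h : K.adj u v) : ({u} : Finset V) ∈ K.faces :=
  K.down _ h.2 _ (by simp) (by simp)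

theorem cg_adj_symm {K : SC V} {u v : V} (h : K.adj u v) : K.adj v u :=
  ⟨h.1.symm, by rw [Finset.pair_comm]; exact h.2⟩

theorem cg_pdist_adj {K : SC V} (hK : K.IsCAT0) {u v : V} (h : K.adj u v) :
    K.pdist (cgPt u) (cgPt v) = 1 := by
  have hu := cg_isPoint_pt (cg_adj_vert h)
  have hv := cg_isPoint_pt (cg_adj_vert (cg_adj_symm h))
  rw [cg_pdist_eq hK hu hv]
  · have := cg_stepD_sq (cgPt u) (cgPt v) {u, v} (by simp [cg_support_pt]) (by simp [cg_support_pt])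
    rw [Finset.sum_pair h.1] at this
    simp [cgPt, Finsupp.single_apply, h.1, h.1.symm] at this
    rcases this with h1 | h1
    · exact h1
    · linarith [cg_stepD_nonneg (cgPt u) (cgPt v), show stepD (cgPt u) (cgPt v) = -1 from h1]
  · unfold SC.SameCell
    rw [cg_support_pt, cg_support_pt]
    exact h.2

/-- In a `3`-complex, a coordinate difference is controlled by the step distance. -/
theorem cg_coord_step {K : SC V} (h3 : K.Is3Dim) {x y : V →₀ ℝ} (hx : K.IsPoint x)
    (hy : K.IsPoint y) (h : K.SameCell x y) (a : V) :
    2 / 3 * (x a - y a) ^ 2 ≤ stepD x y ^ 2 := by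
  set S := x.support ∪ y.support with hS
  have hcard : S.card ≤ 4 := h3 _ h
  have e := cg_stepD_sq x y S Finset.subset_union_left Finset.subset_union_right
  by_cases ha : a ∈ S
  · have sx : ∑ v ∈ S, x v = 1 := by
      rw [← hx.2.1, Finsupp.sum_of_support_subset (s := S)]
      · exact Finset.subset_union_left
      · simp
    have sy : ∑ v ∈ S, y v = 1 := by
      rw [← hy.2.1, Finsupp.sum_of_support_subset (s := S)]
      · exact Finset.subset_union_right
      · simp
    have sz : ∑ v ∈ S, (x v - y v) = 0 := by rw [Finset.sum_sub_distrib, sx, sy]; ring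
    rw [← Finset.add_sum_erase S _ ha] at sz
    rw [← Finset.add_sum_erase S _ ha] at e
    have hcs := sq_sum_le_card_mul_sum_sq (s := S.erase a) (f := fun v => x v - y v)
    have hc : ((S.erase a).card : ℝ) ≤ 3 := by
      have : (S.erase a).card ≤ 3 := by rw [Finset.card_erase_of_mem ha]; omega
      exact_mod_cast this
    have hnn : 0 ≤ ∑ v ∈ S.erase a, (x v - y v) ^ 2 := Finset.sum_nonneg fun _ _ => sq_nonneg _
    have e2 : ∑ v ∈ S.erase a, (x v - y v) = -(x a - y a) := by linarith
    rw [e2] at hcs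
    nlinarith
  · have h1 : x a = 0 := by
      by_contra h; exact ha (Finset.mem_union_left _ (Finsupp.mem_support_iff.2 h))
    have h2 : y a = 0 := by
      by_contra h; exact ha (Finset.mem_union_right _ (Finsupp.mem_support_iff.2 h))
    rw [h1, h2]; simpa using sq_nonneg (stepD x y)

/-- Nonadjacent vertices are at distance at least twice the height of a regular tetrahedron. -/
theorem cg_far {K : SC V} (h3 : K.Is3Dim) (hK : K.IsCAT0) {a c : V} (hne : a ≠ c)
    (ha : ({a} : Finset V) ∈ K.faces) (hc : ({c} : Finset V) ∈ K.faces) (h : ¬ K.adj a c) :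
    8 / 3 ≤ K.pdist (cgPt a) (cgPt c) ^ 2 := by
  have key := cg_le_pdist hK
    (fun x y => √(2 / 3) * |(x a - x c) - (y a - y c)|) (by simp) ?_ ?_
    (cg_isPoint_pt ha) (cg_isPoint_pt hc)
  · have e : |((cgPt a) a - (cgPt a) c) - ((cgPt c) a - (cgPt c) c)| = (2 : ℝ) := by
      simp [cgPt, Finsupp.single_apply, hne, hne.symm]; norm_num
    simp only [e] at key
    have h2 : (√(2 / 3) * 2) ^ 2 = (8 / 3 : ℝ) := by
      rw [mul_pow, Real.sq_sqrt (by norm_num)]; norm_num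
    rw [← h2]
    exact pow_le_pow_left₀ (by positivity) key 2
  · intro x y z
    rw [← mul_add]
    exact mul_le_mul_of_nonneg_left (abs_sub_le _ _ _) (Real.sqrt_nonneg _)
  · intro x y hx hy hxy
    refine le_of_sq_le_sq_cg ?_ (cg_stepD_nonneg _ _)
    rw [mul_pow, Real.sq_sqrt (by norm_num), sq_abs]
    have : ¬ (a ∈ x.support ∪ y.support ∧ c ∈ x.support ∪ y.support) := by
      rintro ⟨h1, h2⟩
      exact h ⟨hne, K.down _ hxy _ (by
        intro v hv
        simp only [Finset.mem_insert, Finset.mem_singleton] at hv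
        rcases hv with rfl | rfl <;> assumption) (by simp)⟩
    rw [not_and_or] at this
    simp only [Finset.mem_union, Finsupp.mem_support_iff, not_or, not_not] at this
    rcases this with ⟨h1, h2⟩ | ⟨h1, h2⟩
    · rw [h1, h2]
      have := cg_coord_step h3 hx hy hxy c
      nlinarith
    · rw [h1, h2]
      have := cg_coord_step h3 hx hy hxy a
      nlinarith

/-- Triangles are filled. -/
theorem cg_triangle {K : SC V} (hK : K.IsCAT0) {a b c : V} (hab : K.adj a b) (hbc : K.adj b c)
    (hac : K.adj a c) : ({a, b, c} : Finset V) ∈ K.faces := by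
  have nab := hab.1
  have nbc := hbc.1
  have nac := hac.1
  have pa := cg_isPoint_pt (cg_adj_vert hab)
  have pb := cg_isPoint_pt (cg_adj_vert hbc)
  have pc := cg_isPoint_pt (cg_adj_vert (cg_adj_symm hbc))
  set m : V →₀ ℝ := Finsupp.single b (1 / 2) + Finsupp.single c (1 / 2) with hm
  have ma : m a = 0 := by simp [hm, Finsupp.single_apply, nab.symm, nac.symm]
  have mb : m b = 1 / 2 := by simp [hm, Finsupp.single_apply, nbc.symm]
  have mc : m c = 1 / 2 := by simp [hm, Finsupp.single_apply, nbc]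
  have msupp : m.support = {b, c} := by
    ext v
    simp only [Finsupp.mem_support_iff, Finset.mem_insert, Finset.mem_singleton]
    constructor
    · intro hv
      by_contra hcon
      push Not at hcon
      exact hv (by simp [hm, Finsupp.single_apply, hcon.1.symm, hcon.2.symm])
    · rintro (rfl | rfl)
      · rw [mb]; norm_num
      · rw [mc]; norm_num
  have pm : K.IsPoint m := by
    refine ⟨fun v => ?_, ?_, by rw [msupp]; exact hbc.2⟩
    · simp only [hm, Finsupp.add_apply, Finsupp.single_apply]
      split_ifs <;> norm_num
    · rw [Finsupp.sum, msupp, Finset.sum_pair nbc, mb, mc]; norm_num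
  have cell1 : K.SameCell (cgPt b) m := by
    unfold SC.SameCell
    rw [cg_support_pt, msupp]
    convert hbc.2 using 1
    ext v; simp
  have cell2 : K.SameCell m (cgPt c) := by
    unfold SC.SameCell
    rw [cg_support_pt, msupp]
    convert hbc.2 using 1
    ext v; simp
  have hhalf : ∀ r : ℝ, 0 ≤ r → r ^ 2 = 1 / 4 → r = 1 / 2 := by
    intro r h0 h
    nlinarith
  have d1 : K.pdist (cgPt b) m = 1 / 2 := by
    rw [cg_pdist_eq hK pb pm cell1]
    apply hhalf _ (cg_stepD_nonneg _ _)
    rw [cg_stepD_sq _ _ {b, c} (by simp [cg_support_pt]) (by simp [msupp]), Finset.sum_pair nbc,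
      mb, mc]
    simp [cgPt, Finsupp.single_apply, nbc]; norm_num
  have d2 : K.pdist m (cgPt c) = 1 / 2 := by
    rw [cg_pdist_eq hK pm pc cell2]
    apply hhalf _ (cg_stepD_nonneg _ _)
    rw [cg_stepD_sq _ _ {b, c} (by simp [msupp]) (by simp [cg_support_pt]), Finset.sum_pair nbc,
      mb, mc]
    simp [cgPt, Finsupp.single_apply, nbc.symm]; norm_num
  have cn := hK.2.2.2 (cgPt a) (cgPt b) (cgPt c) m pa pb pc pm
    (by rw [d1, cg_pdist_adj hK hbc]) (by rw [d2, cg_pdist_adj hK hbc])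
  rw [cg_pdist_adj hK hab, cg_pdist_adj hK hac, cg_pdist_adj hK hbc] at cn
  obtain ⟨z, pz, z1, z2⟩ := hK.2.2.1 (cgPt a) m pa pm
  have s1 := cg_stepD_le_pdist hK pa pz
  have s2 := cg_stepD_le_pdist hK pz pm
  have q1 : stepD (cgPt a) z ^ 2 ≤ 3 / 16 := by
    have := pow_le_pow_left₀ (cg_stepD_nonneg _ _) s1 2
    rw [z1] at this; nlinarith
  have q2 : stepD z m ^ 2 ≤ 3 / 16 := by
    have := pow_le_pow_left₀ (cg_stepD_nonneg _ _) s2 2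
    rw [z2] at this; nlinarith
  set S : Finset V := {a, b, c} ∪ z.support with hS
  have za : z.support ⊆ S := Finset.subset_union_right
  have ssub : ({a, b, c} : Finset V) ⊆ S := Finset.subset_union_left
  have am : (cgPt a).support ⊆ S := by
    rw [cg_support_pt]; exact subset_trans (by simp) ssub
  have mm : m.support ⊆ S := by
    rw [msupp]; exact subset_trans (by intro v; simp; tauto) ssub
  rw [cg_stepD_sq _ _ S am za] at q1
  rw [cg_stepD_sq _ _ S za mm] at q2
  have q3 : ∑ v ∈ S, (cgPt a v - m v) ^ 2 = 3 / 2 := by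
    rw [← Finset.sum_subset ssub, Finset.sum_insert (by simp [nab, nac]), Finset.sum_pair nbc,
      ma, mb, mc]
    · simp [cgPt, Finsupp.single_apply, nab, nac]; norm_num
    · intro v _ hv
      simp only [Finset.mem_insert, Finset.mem_singleton, not_or] at hv
      simp [hm, cgPt, Finsupp.single_apply, Ne.symm hv.1, Ne.symm hv.2.1, Ne.symm hv.2.2]
  have q4 : ∑ v ∈ S, (z v - (cgPt a v + m v) / 2) ^ 2 ≤ 0 := by
    have : ∑ v ∈ S, (cgPt a v - z v) ^ 2 + ∑ v ∈ S, (z v - m v) ^ 2 =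
      2 * ∑ v ∈ S, (z v - (cgPt a v + m v) / 2) ^ 2 + (1 / 2) * ∑ v ∈ S, (cgPt a v - m v) ^ 2 := by
      rw [Finset.mul_sum, Finset.mul_sum, ← Finset.sum_add_distrib, ← Finset.sum_add_distrib]
      exact Finset.sum_congr rfl fun v _ => by ring
    linarith
  have q5 : ∀ v ∈ S, z v = (cgPt a v + m v) / 2 := by
    have h0 := le_antisymm q4 (Finset.sum_nonneg fun _ _ => sq_nonneg _)
    rw [Finset.sum_eq_zero_iff_of_nonneg fun _ _ => sq_nonneg _] at h0
    intro v hv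
    have := h0 v hv
    have := pow_eq_zero_iff (two_ne_zero) |>.1 this
    linarith
  apply K.down _ pz.2.2 _ _ (by simp)
  intro v hv
  rw [Finsupp.mem_support_iff, q5 v (ssub hv)]
  simp only [Finset.mem_insert, Finset.mem_singleton] at hv
  rcases hv with rfl | rfl | rfl
  · rw [ma]; simp [cgPt]
  · rw [mb]; simp [cgPt, Finsupp.single_apply, nab]
  · rw [mc]; simp [cgPt, Finsupp.single_apply, nac]

theorem cg_adj_pt {K : SC V} {u v : V} (h : K.adj u v) : K.IsPoint (cgPt u) :=
  cg_isPoint_pt (cg_adj_vert h)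

/-- Squares have a chord. -/
theorem cg_square {K : SC V} (h3 : K.Is3Dim) (hK : K.IsCAT0) {a b c d : V} (hab : K.adj a b)
    (hbc : K.adj b c) (hcd : K.adj c d) (hda : K.adj d a) (nac : a ≠ c) (nbd : b ≠ d) :
    K.adj a c ∨ K.adj b d := by
  by_contra hcon
  push Not at hcon
  have pa := cg_adj_pt hab
  have pb := cg_adj_pt hbc
  have pc := cg_adj_pt hcd
  have pd := cg_adj_pt hda
  have f1 := cg_far h3 hK nac (cg_adj_vert hab) (cg_adj_vert hcd) hcon.1
  have f2 := cg_far h3 hK nbd (cg_adj_vert hbc) (cg_adj_vert hda) hcon.2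
  obtain ⟨m, pm, m1, m2⟩ := hK.2.2.1 _ _ pa pc
  have c1 := hK.2.2.2 _ _ _ m pb pa pc pm m1 m2
  have c2 := hK.2.2.2 _ _ _ m pd pa pc pm m1 m2
  rw [cg_pdist_adj hK (cg_adj_symm hab), cg_pdist_adj hK hbc] at c1
  rw [cg_pdist_adj hK hda, cg_pdist_adj hK (cg_adj_symm hcd)] at c2
  have t := cg_pdist_triangle hK pb pm pd
  rw [cg_pdist_comm hK pm pd] at t
  have n := cg_pdist_nonneg K (cgPt b) (cgPt d)
  have t2 := pow_le_pow_left₀ n t 2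
  nlinarith [sq_nonneg (K.pdist (cgPt b) m - K.pdist (cgPt d) m)]

/-- The comparison inequality at parameter `5/8`. -/
theorem cg_five_eighths {K : SC V} (hK : K.IsCAT0) {p q : V →₀ ℝ} (hp : K.IsPoint p)
    (hq : K.IsPoint q) : ∃ m, K.IsPoint m ∧ ∀ x, K.IsPoint x → K.pdist x m ^ 2 ≤
      3 / 8 * K.pdist x p ^ 2 + 5 / 8 * K.pdist x q ^ 2 - 15 / 64 * K.pdist p q ^ 2 := by
  obtain ⟨m1, p1, a1, b1⟩ := hK.2.2.1 _ _ hp hq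
  obtain ⟨m2, p2, a2, b2⟩ := hK.2.2.1 _ _ p1 hq
  obtain ⟨m3, p3, a3, b3⟩ := hK.2.2.1 _ _ p1 p2
  refine ⟨m3, p3, fun x hx => ?_⟩
  have c1 := hK.2.2.2 x _ _ m1 hx hp hq p1 a1 b1
  have c2 := hK.2.2.2 x _ _ m2 hx p1 hq p2 a2 b2
  have c3 := hK.2.2.2 x _ _ m3 hx p1 p2 p3 a3 b3
  rw [a2, b1] at c3
  rw [b1] at c2
  nlinarith

/-- Quadrilateral inequality for three unit sides. -/
theorem cg_quad {K : SC V} (hK : K.IsCAT0) {a b c d : V} (hab : K.adj a b)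
    (hbc : K.adj b c) (hcd : K.adj c d) :
    K.pdist (cgPt a) (cgPt c) ^ 2 + K.pdist (cgPt b) (cgPt d) ^ 2 ≤
      11 / 3 + 3 / 5 * K.pdist (cgPt d) (cgPt a) ^ 2 := by
  have pa := cg_adj_pt hab
  have pb := cg_adj_pt hbc
  have pc := cg_adj_pt hcd
  have pd := cg_adj_pt (cg_adj_symm hcd)
  obtain ⟨m, pm, hm⟩ := cg_five_eighths hK pa pc
  have c1 := hm _ pb
  have c2 := hm _ pd
  rw [cg_pdist_adj hK (cg_adj_symm hab), cg_pdist_adj hK hbc] at c1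
  rw [cg_pdist_adj hK (cg_adj_symm hcd)] at c2
  have t := cg_pdist_triangle hK pb pm pd
  rw [cg_pdist_comm hK pm pd] at t
  have n := cg_pdist_nonneg K (cgPt b) (cgPt d)
  have t2 := pow_le_pow_left₀ n t 2
  set X := K.pdist (cgPt b) m
  set Y := K.pdist (cgPt d) m
  have t3 : (X + Y) ^ 2 ≤ 8 / 3 * X ^ 2 + 8 / 5 * Y ^ 2 := by
    nlinarith [sq_nonneg (5 * X - 3 * Y)]
  linarith

/-- Pentagons have a chord. -/
theorem cg_pentagon {K : SC V} (h3 : K.Is3Dim) (hK : K.IsCAT0) {a b c d e : V} (hab : K.adj a b)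
    (hbc : K.adj b c) (hcd : K.adj c d) (hde : K.adj d e) (hea : K.adj e a)
    (nac : a ≠ c) (nbd : b ≠ d) (nce : c ≠ e) (nda : d ≠ a) (neb : e ≠ b) :
    K.adj a c ∨ K.adj b d ∨ K.adj c e ∨ K.adj d a ∨ K.adj e b := by
  by_contra hcon
  push Not at hcon
  obtain ⟨g1, g2, g3, g4, g5⟩ := hcon
  have va := cg_adj_vert hab
  have vb := cg_adj_vert hbc
  have vc := cg_adj_vert hcd
  have vd := cg_adj_vert hde
  have ve := cg_adj_vert hea
  have f1 := cg_far h3 hK nac va vc g1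
  have f2 := cg_far h3 hK nbd vb vd g2
  have f3 := cg_far h3 hK nce vc ve g3
  have f4 := cg_far h3 hK nda vd va g4
  have f5 := cg_far h3 hK neb ve vb g5
  have q1 := cg_quad hK hab hbc hcd
  have q2 := cg_quad hK hbc hcd hde
  have q3 := cg_quad hK hcd hde hea
  have q4 := cg_quad hK hde hea hab
  have q5 := cg_quad hK hea hab hbc
  rw [cg_pdist_comm hK (cg_isPoint_pt vd) (cg_isPoint_pt va)] at *
  rw [cg_pdist_comm hK (cg_isPoint_pt ve) (cg_isPoint_pt vb)] at *
  linarith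

end MetricPart

/-! ## Every edge of the boundary cycle lies in a face -/

section DiskPart

theorem cg_edge_mem_cells {D : SimpDisk} {e : Finset Pt2} (he : e ∈ D.edges) : e ∈ D.cells := by
  unfold SimpDisk.cells
  simp only [Finset.mem_union]
  tauto

theorem cg_hull_sub_supp {D : SimpDisk} {e : Finset Pt2} (he : e ∈ D.cells) :
    convexHull ℝ (e : Set Pt2) ⊆ D.supp := by
  unfold SimpDisk.supp
  exact Set.subset_biUnion_of_mem (u := fun s : Finset Pt2 => convexHull ℝ (s : Set Pt2)) he

theorem cg_isClosed_hull (e : Finset Pt2) : IsClosed (convexHull ℝ (e : Set Pt2)) :=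
  (e.finite_toSet.isCompact_convexHull ℝ).isClosed

/-- The linear parameter along the segment from `u` to `w`. -/
noncomputable def cgParam (u w x : Pt2) : ℝ :=
  ((x.1 - u.1) * (w.1 - u.1) + (x.2 - u.2) * (w.2 - u.2)) /
    ((w.1 - u.1) * (w.1 - u.1) + (w.2 - u.2) * (w.2 - u.2))

theorem cg_param_line {u w : Pt2} (h : u ≠ w) (s : ℝ) :
    cgParam u w (AffineMap.lineMap u w s) = s := by
  have hd : (w.1 - u.1) * (w.1 - u.1) + (w.2 - u.2) * (w.2 - u.2) ≠ 0 := by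
    intro h0
    apply h
    have h1 : w.1 - u.1 = 0 := by nlinarith [mul_self_nonneg (w.1 - u.1), mul_self_nonneg (w.2 - u.2)]
    have h2 : w.2 - u.2 = 0 := by nlinarith [mul_self_nonneg (w.1 - u.1), mul_self_nonneg (w.2 - u.2)]
    exact Prod.ext (by linarith) (by linarith)
  unfold cgParam
  rw [div_eq_iff hd]
  simp [AffineMap.lineMap_apply]
  ring

theorem cg_param_continuous (u w : Pt2) : Continuous (cgParam u w) := by
  unfold cgParam
  fun_prop

theorem cg_edge_in_face (D : SimpDisk) (c : EPath D.adj) (hc : c.Closed) (i : ℕ) (hi : i < c.len)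
    (htight : ∀ j, j < c.len → j ≠ i →
      ({c.f j, c.f (j + 1)} : Finset Pt2) ≠ {c.f i, c.f (i + 1)}) :
    ∃ t ∈ D.facesD, c.f i ∈ t ∧ c.f (i + 1) ∈ t := by
  by_contra hno
  push Not at hno
  obtain ⟨hne, he⟩ := c.step i hi
  set u := c.f i with hu
  set w := c.f (i + 1) with hw
  set e : Finset Pt2 := {u, w} with hedef
  have heC : e ∈ D.cells := cg_edge_mem_cells he
  -- other cells meet `e` in at most one endpoint
  have hother : ∀ s ∈ D.cells, s ≠ e → ¬ (u ∈ s ∧ w ∈ s) := by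
    rintro s hs hse ⟨h1, h2⟩
    have hsub : e ⊆ s := by
      intro v hv
      simp only [hedef, Finset.mem_insert, Finset.mem_singleton] at hv
      rcases hv with rfl | rfl <;> assumption
    have hs' := hs
    unfold SimpDisk.cells at hs'
    simp only [Finset.mem_union, Finset.mem_image] at hs'
    rcases hs' with (⟨v, _, rfl⟩ | h) | h
    · simp only [Finset.mem_singleton] at h1 h2
      exact hne (h1.trans h2.symm)
    · exact hse (Finset.eq_of_subset_of_card_le hsub
        (by rw [D.edge_card s h, D.edge_card e he])).symm
    · exact hno s h h1 h2
  have hparam : ∀ s ∈ D.cells, s ≠ e → ∀ x ∈ convexHull ℝ (s : Set Pt2),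
      x ∈ convexHull ℝ (e : Set Pt2) → ((cgParam u w x : ℝ) : AddCircle (1 : ℝ)) = 0 := by
    intro s hs hse x hx hxe
    have hx2 : x ∈ convexHull ℝ ((s ∩ e : Finset Pt2) : Set Pt2) := by
      rw [← D.glue s hs e heC]; exact ⟨hx, hxe⟩
    have hor : x = u ∨ x = w := by
      have hns := hother s hs hse
      by_cases h1 : u ∈ s
      · have h2 : w ∉ s := fun h2 => hns ⟨h1, h2⟩
        left
        have : convexHull ℝ ((s ∩ e : Finset Pt2) : Set Pt2) ⊆ convexHull ℝ {u} := by
          apply convexHull_mono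
          intro v hv
          simp only [Finset.coe_inter, Set.mem_inter_iff, Finset.mem_coe, hedef,
            Finset.mem_insert, Finset.mem_singleton] at hv
          rcases hv with ⟨hv1, rfl | rfl⟩
          · rfl
          · exact absurd hv1 h2
        simpa using this hx2
      · right
        have : convexHull ℝ ((s ∩ e : Finset Pt2) : Set Pt2) ⊆ convexHull ℝ {w} := by
          apply convexHull_mono
          intro v hv
          simp only [Finset.coe_inter, Set.mem_inter_iff, Finset.mem_coe, hedef,
            Finset.mem_insert, Finset.mem_singleton] at hv
          rcases hv with ⟨hv1, rfl | rfl⟩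
          · exact absurd hv1 h1
          · rfl
        simpa using this hx2
    rcases hor with rfl | rfl
    · have := cg_param_line hne 0
      simp only [AffineMap.lineMap_apply_zero] at this
      rw [this]; simp
    · have := cg_param_line hne 1
      simp only [AffineMap.lineMap_apply_one] at this
      rw [this]; exact AddCircle.coe_period 1
  -- the map to the circle
  set F : Pt2 → AddCircle (1 : ℝ) := fun x =>
    if x ∈ convexHull ℝ (e : Set Pt2) then ((cgParam u w x : ℝ) : AddCircle (1 : ℝ)) else 0 with hF
  have hF0 : ∀ s ∈ D.cells, s ≠ e → ∀ x ∈ convexHull ℝ (s : Set Pt2), F x = 0 := by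
    intro s hs hse x hx
    simp only [hF]
    split_ifs with hxe
    · exact hparam s hs hse x hx hxe
    · rfl
  set B : Set Pt2 := ⋃ s ∈ D.cells.erase e, convexHull ℝ (s : Set Pt2) with hB
  have hBcl : IsClosed B := by
    apply isClosed_biUnion_finset
    intro s _
    exact cg_isClosed_hull s
  have hcont : ContinuousOn F (convexHull ℝ (e : Set Pt2) ∪ B) := by
    apply ContinuousOn.union_of_isClosed _ _ (cg_isClosed_hull e) hBcl
    · apply ContinuousOn.congr (f := fun x => ((cgParam u w x : ℝ) : AddCircle (1 : ℝ)))
      · exact ((AddCircle.continuous_mk' (1 : ℝ)).comp (cg_param_continuous u w)).continuousOn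
      · intro x hx
        simp only [hF, if_pos hx]
    · apply ContinuousOn.congr (f := fun _ => (0 : AddCircle (1 : ℝ))) continuousOn_const
      intro x hx
      simp only [hB, Set.mem_iUnion, exists_prop, Finset.mem_erase] at hx
      obtain ⟨s, ⟨hse, hs⟩, hx⟩ := hx
      exact hF0 s hs hse x hx
  have hcont' : ContinuousOn F D.supp := by
    apply hcont.mono
    intro x hx
    simp only [SimpDisk.supp, Set.mem_iUnion, exists_prop] at hx
    obtain ⟨s, hs, hx⟩ := hx
    by_cases hse : s = e
    · left; rw [← hse]; exact hx
    · right
      simp only [hB, Set.mem_iUnion, exists_prop, Finset.mem_erase]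
      exact ⟨s, ⟨hse, hs⟩, hx⟩
  haveI : ContractibleSpace D.supp := D.contractible
  let FX : C(D.supp, AddCircle (1 : ℝ)) := ⟨fun x => F x.1, hcont'.restrict⟩
  -- lift to the line
  obtain ⟨g, hg⟩ : ∃ g : C(D.supp, ℝ), ∀ x, ((g x : ℝ) : AddCircle (1 : ℝ)) = F x.1 := by
    obtain ⟨p, ⟨H⟩⟩ := id_nullhomotopic D.supp
    let H' : C(unitInterval × D.supp, AddCircle (1 : ℝ)) := FX.comp H.symm.toContinuousMap
    obtain ⟨r, hr⟩ := QuotientAddGroup.mk_surjective (FX p)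
    have cov := AddCircle.isCoveringMap_coe (1 : ℝ)
    have h0 : ∀ a, H' (0, a) = (((ContinuousMap.const D.supp r) a : ℝ) : AddCircle (1 : ℝ)) := by
      intro a
      have : H.symm (0, a) = p := by simp
      show FX (H.symm (0, a)) = _
      rw [this]
      exact hr.symm
    refine ⟨(cov.liftHomotopy H' (ContinuousMap.const D.supp r) h0).comp
      ⟨fun x => (1, x), by fun_prop⟩, fun x => ?_⟩
    have := congrFun (cov.liftHomotopy_lifts H' (ContinuousMap.const D.supp r) h0) (1, x)
    refine this.trans ?_
    show FX (H.symm (1, x)) = _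
    have : H.symm (1, x) = x := by simp
    rw [this]
    rfl
  -- points of the cycle lie in the support
  have hmemseg : ∀ j, j < c.len → ∀ s : unitInterval,
      AffineMap.lineMap (c.f j) (c.f (j + 1)) (s : ℝ) ∈
        convexHull ℝ (({c.f j, c.f (j + 1)} : Finset Pt2) : Set Pt2) := by
    intro j _ s
    rw [Finset.coe_pair, convexHull_pair, segment_eq_image_lineMap]
    exact ⟨s, s.2, rfl⟩
  have hsub : ∀ j (_ : j < c.len), convexHull ℝ (({c.f j, c.f (j + 1)} : Finset Pt2) : Set Pt2)
      ⊆ D.supp := fun j hj => cg_hull_sub_supp (cg_edge_mem_cells (c.step j hj).2)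
  let G : ℕ → ℝ := fun j => if h : c.f j ∈ D.supp then g ⟨c.f j, h⟩ else 0
  have hGpath : ∀ j (hj : j < c.len), ∃ φ : unitInterval → ℝ, Continuous φ ∧ φ 0 = G j ∧
      φ 1 = G (j + 1) ∧ ∀ s, ((φ s : ℝ) : AddCircle (1 : ℝ)) =
        F (AffineMap.lineMap (c.f j) (c.f (j + 1)) (s : ℝ)) := by
    intro j hj
    refine ⟨fun s => g ⟨AffineMap.lineMap (c.f j) (c.f (j + 1)) (s : ℝ),
      hsub j hj (hmemseg j hj s)⟩, ?_, ?_, ?_, fun s => hg _⟩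
    · apply g.continuous.comp
      apply Continuous.subtype_mk
      exact AffineMap.lineMap_continuous.comp continuous_subtype_val
    · have h : c.f j ∈ D.supp := by
        have := hsub j hj (hmemseg j hj 0); simpa using this
      simp only [G, dif_pos h]
      congr 1; simp
    · have h : c.f (j + 1) ∈ D.supp := by
        have := hsub j hj (hmemseg j hj 1); simpa using this
      simp only [G, dif_pos h]
      congr 1; simp
  have cov := AddCircle.isCoveringMap_coe (1 : ℝ)
  have hGeq : ∀ j, j < c.len → j ≠ i → G j = G (j + 1) := by
    intro j hj hji
    obtain ⟨φ, h1, h2, h3, h4⟩ := hGpath j hj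
    have hz : ∀ s, ((φ s : ℝ) : AddCircle (1 : ℝ)) = 0 := by
      intro s
      rw [h4]
      exact hF0 _ (cg_edge_mem_cells (c.step j hj).2) (htight j hj hji) _ (hmemseg j hj s)
    rw [← h2, ← h3]
    exact cov.const_of_comp h1 (fun a b => by rw [hz, hz]) 0 1
  have hGi : G (i + 1) = G i + 1 := by
    obtain ⟨φ, h1, h2, h3, h4⟩ := hGpath i hi
    have hz : ∀ s : unitInterval, (((φ s - (s : ℝ)) : ℝ) : AddCircle (1 : ℝ)) = 0 := by
      intro s
      rw [AddCircle.coe_sub, h4]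
      simp only [hF]
      rw [if_pos (hmemseg i hi s), cg_param_line hne, sub_self]
    have := cov.const_of_comp (g := fun s : unitInterval => φ s - (s : ℝ)) (by fun_prop)
      (fun a b => by rw [hz, hz]) 0 1
    simp only [Set.Icc.coe_zero, Set.Icc.coe_one] at this
    rw [← h2, ← h3]; linarith
  have hup : ∀ j, j ≤ i → G j = G 0 := by
    intro j
    induction j with
    | zero => intro _; rfl
    | succ j ih => intro hj; rw [← hGeq j (by omega) (by omega)]; exact ih (by omega)
  have hdown : ∀ k, i + 1 + k ≤ c.len → G (i + 1 + k) = G (i + 1) := by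
    intro k
    induction k with
    | zero => intro _; rfl
    | succ k ih =>
      intro hk
      rw [← ih (by omega)]
      exact (hGeq (i + 1 + k) (by omega) (by omega)).symm
  have h1 := hup i le_rfl
  have h2 := hdown (c.len - (i + 1)) (by omega)
  rw [show i + 1 + (c.len - (i + 1)) = c.len by omega] at h2
  have h3 : G c.len = G 0 := by
    have : c.f c.len = c.f 0 := hc
    simp only [G, this]
  linarith

end DiskPart

/-! ## Explicit fan-shaped disks -/

section FanPart

/-- The vertices of the planar fans. -/
def cgQ : ℕ → Pt2
  | 0 => (0, 0)
  | 1 => (1, 0)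
  | 2 => (1, 1)
  | 3 => (0, 1)
  | _ => (-1, 1)

theorem cgQ_inj {i j : ℕ} (hi : i < 5) (hj : j < 5) (h : cgQ i = cgQ j) : i = j := by
  interval_cases i <;> interval_cases j <;> first | rfl | (exfalso; norm_num [cgQ] at h)

/-- The hat functions (piecewise linear barycentric coordinates) of the fan. -/
noncomputable def cgHat : ℕ → Pt2 → ℝ
  | 0, p => 1 - max p.1 p.2
  | 1, p => max 0 (p.1 - p.2)
  | 2, p => max 0 (min p.1 p.2)
  | 3, p => max 0 (p.2 - |p.1|)
  | _, p => max 0 (-p.1)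

/-- The triangles of the fan. -/
noncomputable def cgT (i : ℕ) : Finset Pt2 := {cgQ 0, cgQ i, cgQ (i + 1)}

noncomputable def cgVerts (n : ℕ) : Finset Pt2 := (Finset.range n).image cgQ

noncomputable def cgEdges (n : ℕ) : Finset (Finset Pt2) :=
  (Finset.range n).image (fun i => {cgQ i, cgQ ((i + 1) % n)}) ∪
    (Finset.Ico 1 n).image (fun i => {cgQ 0, cgQ i})

noncomputable def cgFaces (n : ℕ) : Finset (Finset Pt2) := (Finset.Ico 1 (n - 1)).image cgT

noncomputable def cgCells (n : ℕ) : Finset (Finset Pt2) :=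
  (cgVerts n).image (fun v => ({v} : Finset Pt2)) ∪ cgEdges n ∪ cgFaces n

theorem cg_mem_edges {n : ℕ} {e : Finset Pt2} : e ∈ cgEdges n ↔
    (∃ i, i < n ∧ e = {cgQ i, cgQ ((i + 1) % n)}) ∨ (∃ i, 1 ≤ i ∧ i < n ∧ e = {cgQ 0, cgQ i}) := by
  unfold cgEdges
  simp only [Finset.mem_union, Finset.mem_image, Finset.mem_range, Finset.mem_Ico]
  constructor
  · rintro (⟨i, h, rfl⟩ | ⟨i, h, rfl⟩)
    · exact Or.inl ⟨i, h, rfl⟩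
    · exact Or.inr ⟨i, h.1, h.2, rfl⟩
  · rintro (⟨i, h, rfl⟩ | ⟨i, h, h', rfl⟩)
    · exact Or.inl ⟨i, h, rfl⟩
    · exact Or.inr ⟨i, ⟨h, h'⟩, rfl⟩

theorem cg_mem_faces {n : ℕ} {t : Finset Pt2} : t ∈ cgFaces n ↔
    ∃ i, 1 ≤ i ∧ i < n - 1 ∧ t = cgT i := by
  unfold cgFaces
  simp only [Finset.mem_image, Finset.mem_Ico]
  constructor
  · rintro ⟨i, h, rfl⟩; exact ⟨i, h.1, h.2, rfl⟩
  · rintro ⟨i, h, h', rfl⟩; exact ⟨i, ⟨h, h'⟩, rfl⟩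

theorem cg_mem_verts {n : ℕ} {v : Pt2} : v ∈ cgVerts n ↔ ∃ i, i < n ∧ v = cgQ i := by
  unfold cgVerts
  simp only [Finset.mem_image, Finset.mem_range, eq_comm]

theorem cg_mem_T {i : ℕ} {v : Pt2} : v ∈ cgT i ↔ v = cgQ 0 ∨ v = cgQ i ∨ v = cgQ (i + 1) := by
  simp [cgT]

theorem cg_verts_T {n : ℕ} (hn : 3 ≤ n) {j : ℕ} (hj : j < n) :
    ∃ i, 1 ≤ i ∧ i < n - 1 ∧ cgQ j ∈ cgT i := by
  rcases Nat.lt_or_ge j 2 with h | h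
  · refine ⟨1, le_rfl, by omega, ?_⟩
    rw [cg_mem_T]
    interval_cases j <;> simp
  · refine ⟨j - 1, by omega, by omega, ?_⟩
    rw [cg_mem_T, show j - 1 + 1 = j by omega]
    simp

theorem cg_edge_T {n : ℕ} (hn : 3 ≤ n) {e : Finset Pt2} (he : e ∈ cgEdges n) :
    ∃ i, 1 ≤ i ∧ i < n - 1 ∧ e ⊆ cgT i := by
  have hpair : ∀ i, 1 ≤ i → i < n → ∃ k, 1 ≤ k ∧ k < n - 1 ∧ ({cgQ 0, cgQ i} : Finset Pt2) ⊆ cgT k := by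
    intro i h1 h2
    obtain ⟨k, hk1, hk2, hk3⟩ := cg_verts_T hn h2
    refine ⟨k, hk1, hk2, ?_⟩
    intro v hv
    simp only [Finset.mem_insert, Finset.mem_singleton] at hv
    rcases hv with rfl | rfl
    · rw [cg_mem_T]; simp
    · exact hk3
  rw [cg_mem_edges] at he
  rcases he with ⟨i, hi, rfl⟩ | ⟨i, h1, h2, rfl⟩
  · by_cases h0 : i = 0
    · subst h0
      rw [Nat.mod_eq_of_lt (by omega)]
      exact hpair 1 le_rfl (by omega)
    by_cases h1 : i = n - 1
    · have : (i + 1) % n = 0 := by rw [h1, Nat.sub_add_cancel (by omega), Nat.mod_self]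
      rw [this, Finset.pair_comm]
      exact hpair i (by omega) hi
    · rw [Nat.mod_eq_of_lt (by omega)]
      refine ⟨i, by omega, by omega, ?_⟩
      intro v hv
      simp only [Finset.mem_insert, Finset.mem_singleton] at hv
      rw [cg_mem_T]; tauto
  · exact hpair i h1 h2

theorem cg_cell_T {n : ℕ} (hn : 3 ≤ n) {s : Finset Pt2} (hs : s ∈ cgCells n) :
    ∃ i, 1 ≤ i ∧ i < n - 1 ∧ s ⊆ cgT i := by
  unfold cgCells at hs
  simp only [Finset.mem_union, Finset.mem_image] at hs
  rcases hs with (⟨v, hv, rfl⟩ | h) | h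
  · obtain ⟨j, hj, rfl⟩ := cg_mem_verts.1 hv
    obtain ⟨i, h1, h2, h3⟩ := cg_verts_T hn hj
    exact ⟨i, h1, h2, by simpa using h3⟩
  · exact cg_edge_T hn h
  · obtain ⟨i, h1, h2, rfl⟩ := cg_mem_faces.1 h
    exact ⟨i, h1, h2, subset_rfl⟩

theorem cg_T_cell {n i : ℕ} (h1 : 1 ≤ i) (h2 : i < n - 1) : cgT i ∈ cgCells n := by
  unfold cgCells
  exact Finset.mem_union_right _ (cg_mem_faces.2 ⟨i, h1, h2, rfl⟩)

theorem cg_hull_weights {A B C : Pt2} (hAB : A ≠ B) (hAC : A ≠ C) (hBC : B ≠ C) {s : Finset Pt2}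
    (hs : s ⊆ {A, B, C}) {x : Pt2} (hx : x ∈ convexHull ℝ (s : Set Pt2)) :
    ∃ a b c : ℝ, 0 ≤ a ∧ 0 ≤ b ∧ 0 ≤ c ∧ a + b + c = 1 ∧ x = a • A + b • B + c • C ∧
      (A ∉ s → a = 0) ∧ (B ∉ s → b = 0) ∧ (C ∉ s → c = 0) := by
  rw [Finset.mem_convexHull'] at hx
  obtain ⟨w, w0, w1, w2⟩ := hx
  set w' : Pt2 → ℝ := fun v => if v ∈ s then w v else 0 with hw'
  have e1 : ∑ v ∈ ({A, B, C} : Finset Pt2), w' v = 1 := by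
    rw [← w1, ← Finset.sum_subset hs]
    · exact Finset.sum_congr rfl fun v hv => by simp [hw', hv]
    · intro v _ hv; simp [hw', hv]
  have e2 : ∑ v ∈ ({A, B, C} : Finset Pt2), w' v • v = x := by
    rw [← w2, ← Finset.sum_subset hs]
    · exact Finset.sum_congr rfl fun v hv => by simp [hw', hv]
    · intro v _ hv; simp [hw', hv]
  have hnn : ∀ v, 0 ≤ w' v := by
    intro v; simp only [hw']; split_ifs with h
    · exact w0 v h
    · exact le_rfl
  rw [Finset.sum_insert (by simp [hAB, hAC]), Finset.sum_pair hBC, ← add_assoc] at e1 e2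
  exact ⟨w' A, w' B, w' C, hnn _, hnn _, hnn _, e1, e2.symm, fun h => by simp [hw', h],
    fun h => by simp [hw', h], fun h => by simp [hw', h]⟩

/-- The barycentric description of the hull of a cell. -/
theorem cg_hull_hat {i : ℕ} (h1 : 1 ≤ i) (h2 : i < 4) {s : Finset Pt2} (hs : s ⊆ cgT i)
    {x : Pt2} (hx : x ∈ convexHull ℝ (s : Set Pt2)) :
    (∀ j, j < 5 → 0 ≤ cgHat j x) ∧ (∀ j, j < 5 → cgQ j ∉ s → cgHat j x = 0) ∧
    ∑ j ∈ Finset.range 5, cgHat j x = 1 ∧ ∑ j ∈ Finset.range 5, cgHat j x • cgQ j = x := by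
  have n1 : cgQ 0 ≠ cgQ i := fun h => by have := cgQ_inj (by omega) (by omega) h; omega
  have n2 : cgQ 0 ≠ cgQ (i + 1) := fun h => by have := cgQ_inj (by omega) (by omega) h; omega
  have n3 : cgQ i ≠ cgQ (i + 1) := fun h => by have := cgQ_inj (by omega) (by omega) h; omega
  obtain ⟨a, b, c, ha, hb, hc, hsum, rfl, za, zb, zc⟩ := cg_hull_weights n1 n2 n3 hs hx
  have hval : ∀ j, j < 5 → cgHat j (a • cgQ 0 + b • cgQ i + c • cgQ (i + 1)) =
      if j = 0 then a else if j = i then b else if j = i + 1 then c else 0 := by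
    intro j hj
    interval_cases i <;> interval_cases j <;>
      simp only [cgHat, cgQ, Prod.smul_mk, Prod.mk_add_mk, smul_eq_mul] <;> norm_num <;>
      first
        | linarith
        | (rw [max_eq_left (by linarith)]; linarith)
        | (rw [max_eq_right (by linarith)]; linarith)
        | (rw [min_eq_left (by linarith), max_eq_right (by linarith)])
        | (rw [min_eq_right (by linarith), max_eq_right (by linarith)])
        | (rw [abs_of_nonneg (by linarith)]; linarith)
        | (rw [abs_of_nonpos (by linarith)]; linarith)
        | (rw [abs_of_nonneg hb, max_eq_right (by linarith)]; linarith)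
        | (rw [abs_of_nonneg hc, max_eq_right (by linarith)]; linarith)
        | (left; assumption)
  refine ⟨fun j hj => ?_, fun j hj hjs => ?_, ?_, ?_⟩
  · rw [hval j hj]; split_ifs <;> first | assumption | exact le_rfl
  · rw [hval j hj]
    split_ifs with e0 e1 e2
    · subst e0; exact za hjs
    · subst e1; exact zb hjs
    · subst e2; exact zc hjs
    · rfl
  · rw [Finset.sum_congr rfl fun j hj => hval j (Finset.mem_range.1 hj)]
    interval_cases i <;> simp [Finset.sum_range_succ] <;> linarith
  · rw [Finset.sum_congr rfl fun j hj => by rw [hval j (Finset.mem_range.1 hj)]]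
    interval_cases i <;> simp [Finset.sum_range_succ]

theorem cg_glue {n : ℕ} (hn : 3 ≤ n) (hn5 : n ≤ 5) {s t : Finset Pt2} (hs : s ∈ cgCells n)
    (ht : t ∈ cgCells n) : convexHull ℝ (s : Set Pt2) ∩ convexHull ℝ (t : Set Pt2) =
        convexHull ℝ ((s ∩ t : Finset Pt2) : Set Pt2) := by
  apply Set.Subset.antisymm
  · rintro x ⟨hxs, hxt⟩
    obtain ⟨i, i1, i2, i3⟩ := cg_cell_T hn hs
    obtain ⟨k, k1, k2, k3⟩ := cg_cell_T hn ht
    obtain ⟨p1, p2, p3, p4⟩ := cg_hull_hat i1 (by omega) i3 hxs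
    obtain ⟨-, q2, -, -⟩ := cg_hull_hat k1 (by omega) k3 hxt
    set R := (Finset.range 5).filter (fun j => cgHat j x ≠ 0) with hR
    have r3 : ∑ j ∈ R, cgHat j x = 1 := by
      rw [hR, Finset.sum_filter_ne_zero]; exact p3
    have r4 : ∑ j ∈ R, cgHat j x • cgQ j = x := by
      rw [hR, Finset.sum_filter_of_ne]
      · exact p4
      · intro j _ hj h0
        apply hj; rw [h0, zero_smul]
    have hmem := (convex_convexHull ℝ ((s ∩ t : Finset Pt2) : Set Pt2)).sum_mem (t := R)
      (w := fun j => cgHat j x) (z := cgQ) ?_ r3 ?_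
    · rw [r4] at hmem; exact hmem
    · intro j hj
      rw [hR, Finset.mem_filter, Finset.mem_range] at hj
      exact p1 j hj.1
    · intro j hj
      rw [hR, Finset.mem_filter, Finset.mem_range] at hj
      apply subset_convexHull
      rw [Finset.mem_coe, Finset.mem_inter]
      constructor
      · by_contra h; exact hj.2 (p2 j hj.1 h)
      · by_contra h; exact hj.2 (q2 j hj.1 h)
  · apply Set.subset_inter <;> apply convexHull_mono
    · exact_mod_cast Finset.inter_subset_left
    · exact_mod_cast Finset.inter_subset_right

theorem cg_union_star {n : ℕ} (hn : 3 ≤ n) : StarConvex ℝ (cgQ 0)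
    (⋃ s ∈ cgCells n, convexHull ℝ (s : Set Pt2)) := by
  intro y hy a b ha hb hab
  simp only [Set.mem_iUnion, exists_prop] at hy ⊢
  obtain ⟨s, hs, hy⟩ := hy
  obtain ⟨i, i1, i2, i3⟩ := cg_cell_T hn hs
  refine ⟨cgT i, cg_T_cell i1 i2, ?_⟩
  apply convex_convexHull ℝ _ _ _ ha hb hab
  · apply subset_convexHull
    rw [Finset.mem_coe, cg_mem_T]; simp
  · exact convexHull_mono (by exact_mod_cast i3) hy

theorem cg_sub_triple {A B C : Pt2} {e : Finset Pt2} (he : e ⊆ {A, B, C}) (hc : e.card = 2) :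
    e = {A, B} ∨ e = {A, C} ∨ e = {B, C} := by
  obtain ⟨x, y, hxy, rfl⟩ := Finset.card_eq_two.1 hc
  have hx : x ∈ ({A, B, C} : Finset Pt2) := he (by simp)
  have hy : y ∈ ({A, B, C} : Finset Pt2) := he (by simp)
  simp only [Finset.mem_insert, Finset.mem_singleton] at hx hy
  rcases hx with rfl | rfl | rfl <;> rcases hy with rfl | rfl | rfl <;>
    first
      | exact absurd rfl hxy
      | (left; rfl)
      | (left; exact Finset.pair_comm _ _)
      | (right; left; rfl)
      | (right; left; exact Finset.pair_comm _ _)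
      | (right; right; rfl)
      | (right; right; exact Finset.pair_comm _ _)

theorem cgQ_ne {i j : ℕ} (hi : i < 5) (hj : j < 5) (h : i ≠ j) : cgQ i ≠ cgQ j :=
  fun h' => h (cgQ_inj hi hj h')

theorem cg_mod_ne {n i : ℕ} (hn : 3 ≤ n) (hi : i < n) : i ≠ (i + 1) % n := by
  by_cases h1 : i = n - 1
  · have : (i + 1) % n = 0 := by rw [h1, Nat.sub_add_cancel (by omega), Nat.mod_self]
    omega
  · rw [Nat.mod_eq_of_lt (by omega)]; omega

theorem cg_nondegen {i : ℕ} (h1 : 1 ≤ i) (h2 : i < 4) :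
    ¬ Collinear ℝ ((cgT i : Finset Pt2) : Set Pt2) := by
  intro h
  have h0 : cgQ 0 ∈ ((cgT i : Finset Pt2) : Set Pt2) := by rw [Finset.mem_coe, cg_mem_T]; simp
  rw [collinear_iff_of_mem h0] at h
  obtain ⟨v, hv⟩ := h
  obtain ⟨r, hr⟩ := hv (cgQ i) (by rw [Finset.mem_coe, cg_mem_T]; simp)
  obtain ⟨q, hq⟩ := hv (cgQ (i + 1)) (by rw [Finset.mem_coe, cg_mem_T]; simp)
  have e1 := congrArg Prod.fst hr
  have e2 := congrArg Prod.snd hr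
  have e3 := congrArg Prod.fst hq
  have e4 := congrArg Prod.snd hq
  have hdet : (cgQ i).1 * (cgQ (i + 1)).2 - (cgQ i).2 * (cgQ (i + 1)).1 = 1 := by
    interval_cases i <;> norm_num [cgQ]
  rw [e1, e2, e3, e4] at hdet
  simp [cgQ] at hdet
  linarith [hdet, mul_comm (r * v.1) (q * v.2), show r * v.1 * (q * v.2) - r * v.2 * (q * v.1) = 0 by ring]

/-- The fan disk with `n` boundary vertices. -/
noncomputable def cgDisk (n : ℕ) (hn : 3 ≤ n) (hn5 : n ≤ 5) : SimpDisk where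
  verts := cgVerts n
  edges := cgEdges n
  facesD := cgFaces n
  verts_nonempty := ⟨cgQ 0, cg_mem_verts.2 ⟨0, by omega, rfl⟩⟩
  edge_card := by
    intro e he
    rw [cg_mem_edges] at he
    rcases he with ⟨i, hi, rfl⟩ | ⟨i, h1, h2, rfl⟩
    · have := Nat.mod_lt (i + 1) (show 0 < n by omega)
      exact Finset.card_pair (cgQ_ne (by omega) (by omega) (cg_mod_ne hn hi))
    · exact Finset.card_pair (cgQ_ne (by omega) (by omega) (by omega))
  edge_sub := by
    intro e he v hv
    rw [cg_mem_edges] at he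
    rcases he with ⟨i, hi, rfl⟩ | ⟨i, h1, h2, rfl⟩
    · have := Nat.mod_lt (i + 1) (show 0 < n by omega)
      simp only [Finset.mem_insert, Finset.mem_singleton] at hv
      rw [cg_mem_verts]
      rcases hv with rfl | rfl
      · exact ⟨_, hi, rfl⟩
      · exact ⟨_, this, rfl⟩
    · simp only [Finset.mem_insert, Finset.mem_singleton] at hv
      rw [cg_mem_verts]
      rcases hv with rfl | rfl
      · exact ⟨0, by omega, rfl⟩
      · exact ⟨_, h2, rfl⟩
  face_card := by
    intro t ht
    obtain ⟨i, h1, h2, rfl⟩ := cg_mem_faces.1 ht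
    unfold cgT
    rw [Finset.card_eq_three]
    exact ⟨_, _, _, cgQ_ne (by omega) (by omega) (by omega), cgQ_ne (by omega) (by omega) (by omega),
      cgQ_ne (by omega) (by omega) (by omega), rfl⟩
  face_sub := by
    intro t ht v hv
    obtain ⟨i, h1, h2, rfl⟩ := cg_mem_faces.1 ht
    rw [cg_mem_T] at hv
    rw [cg_mem_verts]
    rcases hv with rfl | rfl | rfl
    · exact ⟨0, by omega, rfl⟩
    · exact ⟨i, by omega, rfl⟩
    · exact ⟨i + 1, by omega, rfl⟩
  face_edges := by
    intro t ht e he hc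
    obtain ⟨i, h1, h2, rfl⟩ := cg_mem_faces.1 ht
    rw [cg_mem_edges]
    rcases cg_sub_triple he hc with rfl | rfl | rfl
    · exact Or.inr ⟨i, h1, by omega, rfl⟩
    · exact Or.inr ⟨i + 1, by omega, by omega, rfl⟩
    · refine Or.inl ⟨i, by omega, ?_⟩
      rw [Nat.mod_eq_of_lt (by omega)]
  face_nondegen := by
    intro t ht
    obtain ⟨i, h1, h2, rfl⟩ := cg_mem_faces.1 ht
    exact cg_nondegen h1 (by omega)
  glue := fun s hs t ht => cg_glue hn hn5 hs ht
  contractible := (cg_union_star hn).contractibleSpace ⟨cgQ 0, by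
    simp only [Set.mem_iUnion, exists_prop]
    refine ⟨cgT 1, cg_T_cell le_rfl (by omega), subset_convexHull ℝ _ ?_⟩
    rw [Finset.mem_coe, cg_mem_T]; simp⟩

end FanPart

section FanBoundary

theorem cg_frontier {X : Set Pt2} {a b c : ℝ} (hab : 0 < a ^ 2 + b ^ 2)
    (hX : ∀ p ∈ X, a * p.1 + b * p.2 ≤ c) {x : Pt2} (hx : x ∈ X)
    (he : a * x.1 + b * x.2 = c) : x ∈ frontier X := by
  refine ⟨subset_closure hx, fun hi => ?_⟩
  rw [mem_interior_iff_mem_nhds] at hi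
  have hc : Continuous (fun t : ℝ => ((x.1 + t * a, x.2 + t * b) : Pt2)) := by fun_prop
  have ht : Filter.Tendsto (fun t : ℝ => ((x.1 + t * a, x.2 + t * b) : Pt2)) (nhds 0) (nhds x) :=
    hc.tendsto' 0 x (by simp)
  have h1 : ∀ᶠ t : ℝ in nhdsWithin 0 (Set.Ioi 0), ((x.1 + t * a, x.2 + t * b) : Pt2) ∈ X :=
    (ht.eventually hi).filter_mono nhdsWithin_le_nhds
  obtain ⟨t, h2, h3⟩ := (h1.and self_mem_nhdsWithin).exists
  have h4 := hX _ h2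
  have h5 : 0 < t := h3
  have h6 := mul_pos h5 hab
  simp only at h4
  nlinarith

theorem cg_cells_eq (n : ℕ) (hn : 3 ≤ n) (hn5 : n ≤ 5) : (cgDisk n hn hn5).cells = cgCells n := rfl

theorem cg_mem_supp {n : ℕ} {hn : 3 ≤ n} {hn5 : n ≤ 5} {p : Pt2} (hp : p ∈ (cgDisk n hn hn5).supp) :
    ∃ i, 1 ≤ i ∧ i < n - 1 ∧ p ∈ convexHull ℝ ((cgT i : Finset Pt2) : Set Pt2) := by
  unfold SimpDisk.supp at hp
  rw [cg_cells_eq] at hp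
  simp only [Set.mem_iUnion, exists_prop] at hp
  obtain ⟨s, hs, hp⟩ := hp
  obtain ⟨i, i1, i2, i3⟩ := cg_cell_T hn hs
  exact ⟨i, i1, i2, convexHull_mono (by exact_mod_cast i3) hp⟩

theorem cg_halfplane_hull {s : Finset Pt2} {a b c : ℝ} (h : ∀ v ∈ s, a * v.1 + b * v.2 ≤ c) {p : Pt2}
    (hp : p ∈ convexHull ℝ (s : Set Pt2)) : a * p.1 + b * p.2 ≤ c := by
  have hconv : Convex ℝ {q : Pt2 | a * q.1 + b * q.2 ≤ c} := by
    intro x hx y hy u v hu hv huv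
    simp only [Set.mem_setOf_eq, Prod.fst_add, Prod.snd_add, Prod.smul_fst, Prod.smul_snd,
      smul_eq_mul] at *
    have : c = u * c + v * c := by rw [← add_mul, huv, one_mul]
    nlinarith [mul_le_mul_of_nonneg_left hx hu, mul_le_mul_of_nonneg_left hy hv]
  exact convexHull_min (fun v hv => h v hv) hconv hp

theorem cg_supp_half {n : ℕ} {hn : 3 ≤ n} {hn5 : n ≤ 5} {a b c : ℝ}
    (hv : ∀ j, j < n → a * (cgQ j).1 + b * (cgQ j).2 ≤ c) :
    ∀ p ∈ (cgDisk n hn hn5).supp, a * p.1 + b * p.2 ≤ c := by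
  intro p hp
  obtain ⟨i, i1, i2, hp⟩ := cg_mem_supp hp
  refine cg_halfplane_hull ?_ hp
  intro v hvT
  rw [cg_mem_T] at hvT
  rcases hvT with rfl | rfl | rfl
  · exact hv _ (by omega)
  · exact hv _ (by omega)
  · exact hv _ (by omega)

theorem cg_edge_frontier_aux {n : ℕ} {hn : 3 ≤ n} {hn5 : n ≤ 5} (a b c : ℝ)
    (hab : 0 < a ^ 2 + b ^ 2) (hv : ∀ j, j < n → a * (cgQ j).1 + b * (cgQ j).2 ≤ c) {i : ℕ} (hi : i < n)
    (h1 : a * (cgQ i).1 + b * (cgQ i).2 = c)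
    (h2 : a * (cgQ ((i + 1) % n)).1 + b * (cgQ ((i + 1) % n)).2 = c) :
    (cgDisk n hn hn5).BEdge {cgQ i, cgQ ((i + 1) % n)} := by
  have he : ({cgQ i, cgQ ((i + 1) % n)} : Finset Pt2) ∈ (cgDisk n hn hn5).edges :=
    cg_mem_edges.2 (Or.inl ⟨i, hi, rfl⟩)
  refine ⟨he, fun p hp => ?_⟩
  refine cg_frontier hab (cg_supp_half hv) (cg_hull_sub_supp (cg_edge_mem_cells he) hp) ?_
  apply le_antisymm
  · refine cg_halfplane_hull ?_ hp
    intro v hv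
    simp only [Finset.mem_insert, Finset.mem_singleton] at hv
    rcases hv with rfl | rfl
    · exact h1.le
    · exact h2.le
  · have := cg_halfplane_hull (a := -a) (b := -b) (c := -c) ?_ hp
    · linarith
    intro v hv
    simp only [Finset.mem_insert, Finset.mem_singleton] at hv
    rcases hv with rfl | rfl <;> linarith

theorem cg_edge_bedge {n : ℕ} (hn : 3 ≤ n) (hn5 : n ≤ 5) {i : ℕ} (hi : i < n) :
    (cgDisk n hn hn5).BEdge {cgQ i, cgQ ((i + 1) % n)} := by
  by_cases hl : i = n - 1
  · have e : (i + 1) % n = 0 := by rw [hl, Nat.sub_add_cancel (by omega), Nat.mod_self]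
    have hcase : n = 3 ∨ n = 4 ∨ n = 5 := by omega
    rcases hcase with h | h | h
    · refine cg_edge_frontier_aux (-1) 1 0 (by norm_num) ?_ hi ?_ ?_
      · intro j hj
        rw [h] at hj
        interval_cases j <;> norm_num [cgQ]
      · rw [hl, h]; norm_num [cgQ]
      · rw [e]; norm_num [cgQ]
    · refine cg_edge_frontier_aux (-1) 0 0 (by norm_num) ?_ hi ?_ ?_
      · intro j hj
        rw [h] at hj
        interval_cases j <;> norm_num [cgQ]
      · rw [hl, h]; norm_num [cgQ]
      · rw [e]; norm_num [cgQ]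
    · refine cg_edge_frontier_aux (-1) (-1) 0 (by norm_num) ?_ hi ?_ ?_
      · intro j hj
        rw [h] at hj
        interval_cases j <;> norm_num [cgQ]
      · rw [hl, h]; norm_num [cgQ]
      · rw [e]; norm_num [cgQ]
  · have e : (i + 1) % n = i + 1 := Nat.mod_eq_of_lt (by omega)
    have hcase : i = 0 ∨ i = 1 ∨ i = 2 ∨ i = 3 := by omega
    rcases hcase with h | h | h
    · refine cg_edge_frontier_aux 0 (-1) 0 (by norm_num) ?_ hi ?_ ?_
      · intro j hj
        have : j < 5 := by omega
        interval_cases j <;> norm_num [cgQ]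
      · rw [h]; norm_num [cgQ]
      · rw [e, h]; norm_num [cgQ]
    · refine cg_edge_frontier_aux 1 0 1 (by norm_num) ?_ hi ?_ ?_
      · intro j hj
        have : j < 5 := by omega
        interval_cases j <;> norm_num [cgQ]
      · rw [h]; norm_num [cgQ]
      · rw [e, h]; norm_num [cgQ]
    · refine cg_edge_frontier_aux 0 1 1 (by norm_num) ?_ hi ?_ ?_
      · intro j hj
        have : j < 5 := by omega
        interval_cases j <;> norm_num [cgQ]
      · rcases h with h | h <;> rw [h] <;> norm_num [cgQ]
      · rw [e]
        rcases h with h | h <;> rw [h] <;> norm_num [cgQ]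

theorem cg_no_ivert {n : ℕ} (hn : 3 ≤ n) (hn5 : n ≤ 5) (v : Pt2) : ¬ (cgDisk n hn hn5).IVert v := by
  rintro ⟨hv, hin⟩
  obtain ⟨i, hi, rfl⟩ := cg_mem_verts.1 hv
  have := (cg_edge_bedge hn hn5 hi).2 (subset_convexHull ℝ _ (by simp : cgQ i ∈ _))
  exact this.2 hin

theorem cg_T_hull {i : ℕ} {a b c : ℝ} (ha : 0 ≤ a) (hb : 0 ≤ b) (hc : 0 ≤ c) (h : a + b + c = 1) :
    a • cgQ 0 + b • cgQ i + c • cgQ (i + 1) ∈ convexHull ℝ ((cgT i : Finset Pt2) : Set Pt2) := by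
  have hmem : ∀ v ∈ cgT i, v ∈ convexHull ℝ ((cgT i : Finset Pt2) : Set Pt2) := fun v hv =>
    subset_convexHull ℝ _ hv
  have := (convex_convexHull ℝ ((cgT i : Finset Pt2) : Set Pt2)).sum_mem (t := Finset.univ)
    (w := ![a, b, c]) (z := ![cgQ 0, cgQ i, cgQ (i + 1)]) ?_ ?_ ?_
  · simpa [Fin.sum_univ_three] using this
  · intro j _; fin_cases j <;> simpa
  · simpa [Fin.sum_univ_three] using h
  · intro j _
    fin_cases j
    · exact hmem _ (by rw [cg_mem_T]; simp)
    · exact hmem _ (by rw [cg_mem_T]; simp)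
    · exact hmem _ (by rw [cg_mem_T]; simp)

theorem cg_T_supp {n : ℕ} {hn : 3 ≤ n} {hn5 : n ≤ 5} {i : ℕ} (h1 : 1 ≤ i) (h2 : i < n - 1) {p : Pt2}
    (hp : p ∈ convexHull ℝ ((cgT i : Finset Pt2) : Set Pt2)) : p ∈ (cgDisk n hn hn5).supp :=
  cg_hull_sub_supp (by rw [cg_cells_eq]; exact cg_T_cell h1 h2) hp

theorem cg_diag2 {n : ℕ} (hn : 3 ≤ n) (hn5 : n ≤ 5) (h4 : 4 ≤ n) :
    ¬ (cgDisk n hn hn5).BEdge {cgQ 0, cgQ 2} := by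
  rintro ⟨-, h⟩
  have hm : ((1 / 2, 1 / 2) : Pt2) ∈ convexHull ℝ (({cgQ 0, cgQ 2} : Finset Pt2) : Set Pt2) := by
    have := (convex_convexHull ℝ (({cgQ 0, cgQ 2} : Finset Pt2) : Set Pt2))
      (subset_convexHull ℝ _ (by simp : cgQ 0 ∈ _)) (subset_convexHull ℝ _ (by simp : cgQ 2 ∈ _))
      (show (0 : ℝ) ≤ 1 / 2 by norm_num) (show (0 : ℝ) ≤ 1 / 2 by norm_num) (by norm_num)
    norm_num [cgQ] at this ⊢
    exact this
  refine (h hm).2 ?_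
  have ho : IsOpen {p : Pt2 | 0 < p.1 ∧ p.1 < 1 ∧ 0 < p.2 ∧ p.2 < 1} := by
    apply_rules [IsOpen.and, isOpen_lt] <;> fun_prop
  refine interior_maximal ?_ ho (by norm_num)
  rintro ⟨x, y⟩ ⟨a1, a2, a3, a4⟩
  simp only at a1 a2 a3 a4
  rcases le_total y x with hxy | hxy
  · refine cg_T_supp (i := 1) le_rfl (by omega) ?_
    have := cg_T_hull (i := 1) (a := 1 - x) (b := x - y) (c := y) (by linarith) (by linarith)
      (by linarith) (by ring)
    convert this using 1
    simp [cgQ]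
  · refine cg_T_supp (i := 2) (by norm_num) (by omega) ?_
    have := cg_T_hull (i := 2) (a := 1 - y) (b := x) (c := y - x) (by linarith) (by linarith)
      (by linarith) (by ring)
    convert this using 1
    simp [cgQ]

theorem cg_diag3 (hn : 3 ≤ 5) (hn5 : 5 ≤ 5) :
    ¬ (cgDisk 5 hn hn5).BEdge {cgQ 0, cgQ 3} := by
  rintro ⟨-, h⟩
  have hm : ((0, 1 / 2) : Pt2) ∈ convexHull ℝ (({cgQ 0, cgQ 3} : Finset Pt2) : Set Pt2) := by
    have := (convex_convexHull ℝ (({cgQ 0, cgQ 3} : Finset Pt2) : Set Pt2))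
      (subset_convexHull ℝ _ (by simp : cgQ 0 ∈ _)) (subset_convexHull ℝ _ (by simp : cgQ 3 ∈ _))
      (show (0 : ℝ) ≤ 1 / 2 by norm_num) (show (0 : ℝ) ≤ 1 / 2 by norm_num) (by norm_num)
    norm_num [cgQ] at this ⊢
    exact this
  refine (h hm).2 ?_
  have ho : IsOpen {p : Pt2 | p.1 < p.2 ∧ -p.1 < p.2 ∧ p.2 < 1} := by
    apply_rules [IsOpen.and, isOpen_lt] <;> fun_prop
  refine interior_maximal ?_ ho (by norm_num)
  rintro ⟨x, y⟩ ⟨a1, a2, a3⟩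
  simp only at a1 a2 a3
  rcases le_total 0 x with hxy | hxy
  · refine cg_T_supp (i := 2) (by norm_num) (by omega) ?_
    have := cg_T_hull (i := 2) (a := 1 - y) (b := x) (c := y - x) (by linarith) (by linarith)
      (by linarith) (by ring)
    convert this using 1
    simp [cgQ]
  · refine cg_T_supp (i := 3) (by norm_num) (by omega) ?_
    have := cg_T_hull (i := 3) (a := 1 - y) (b := y + x) (c := -x) (by linarith) (by linarith)
      (by linarith) (by ring)
    convert this using 1
    simp [cgQ]

theorem cg_bedge_cycle {n : ℕ} (hn : 3 ≤ n) (hn5 : n ≤ 5) {e : Finset Pt2}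
    (he : (cgDisk n hn hn5).BEdge e) : ∃ i, i < n ∧ e = {cgQ i, cgQ ((i + 1) % n)} := by
  rcases cg_mem_edges.1 he.1 with h | ⟨i, i1, i2, rfl⟩
  · exact h
  by_cases h1 : i = 1
  · subst h1
    refine ⟨0, by omega, ?_⟩
    rw [Nat.mod_eq_of_lt (by omega)]
  by_cases h2 : i = n - 1
  · refine ⟨n - 1, by omega, ?_⟩
    rw [Nat.sub_add_cancel (by omega), Nat.mod_self, h2, Finset.pair_comm]
  exfalso
  by_cases h3 : i = 2
  · subst h3
    exact cg_diag2 hn hn5 (by omega) he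
  · have h5 : n = 5 := by omega
    have h4 : i = 3 := by omega
    subst h5 h4
    exact cg_diag3 _ _ he

end FanBoundary

section Conclusion

variable {V : Type*} [DecidableEq V]

/-- The index of a fan vertex. -/
noncomputable def cgIdx (p : Pt2) : ℕ := if h : ∃ j, j < 5 ∧ cgQ j = p then h.choose else 0

theorem cgIdx_Q {j : ℕ} (hj : j < 5) : cgIdx (cgQ j) = j := by
  have h : ∃ i, i < 5 ∧ cgQ i = cgQ j := ⟨j, hj, rfl⟩
  unfold cgIdx
  rw [dif_pos h]
  exact cgQ_inj h.choose_spec.1 hj h.choose_spec.2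

theorem cg_per {E : V → V → Prop} {α : EPath E} (hc : α.Closed) {i : ℕ} (hi : i ≤ α.len) :
    α.f (i % α.len) = α.f i := by
  rcases Nat.lt_or_ge i α.len with h | h
  · rw [Nat.mod_eq_of_lt h]
  · have : i = α.len := le_antisymm hi h
    subst this
    rw [Nat.mod_self]
    exact hc.symm

theorem cg_step_mod {K : SC V} {α : EPath K.adj} (hc : α.Closed) (h0 : 0 < α.len) (m : ℕ) :
    K.adj (α.f (m % α.len)) (α.f ((m + 1) % α.len)) := by
  have h1 := Nat.mod_lt m h0
  have := α.step _ h1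
  rw [← cg_per hc (show m % α.len + 1 ≤ α.len from h1), Nat.mod_add_mod] at this
  exact this

/-- The boundary path of the fan disk, rotated by `k`. -/
noncomputable def cgBC (n : ℕ) (hn : 3 ≤ n) (hn5 : n ≤ 5) (k : ℕ) :
    EPath (cgDisk n hn hn5).adj where
  f := fun i => cgQ ((min i n + (n - k)) % n)
  len := n
  step := by
    intro i hi
    have h1 := Nat.mod_lt (i + (n - k)) (show 0 < n by omega)
    have h2 := Nat.mod_lt ((i + (n - k)) % n + 1) (show 0 < n by omega)
    have e1 : (min i n + (n - k)) % n = (i + (n - k)) % n := by rw [min_eq_left (by omega)]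
    have e2 : (min (i + 1) n + (n - k)) % n = ((i + (n - k)) % n + 1) % n := by
      rw [min_eq_left (by omega), Nat.mod_add_mod]
      congr 1; omega
    show (cgDisk n hn hn5).adj _ _
    rw [e1, e2]
    exact ⟨cgQ_ne (by omega) (by omega) (cg_mod_ne hn h1), cg_mem_edges.2 (Or.inl ⟨_, h1, rfl⟩)⟩
  stable := by
    intro i hi
    show cgQ _ = cgQ _
    rw [min_eq_right hi, min_self]

theorem cg_bc_is (n : ℕ) (hn : 3 ≤ n) (hn5 : n ≤ 5) (k : ℕ) (hk : k < n) :
    (cgDisk n hn hn5).IsBoundaryCycle (cgBC n hn hn5 k) := by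
  have hedge : ∀ i, i < n → ({(cgBC n hn hn5 k).f i, (cgBC n hn hn5 k).f (i + 1)} : Finset Pt2) =
      {cgQ ((i + (n - k)) % n), cgQ (((i + (n - k)) % n + 1) % n)} := by
    intro i hi
    have e1 : (min i n + (n - k)) % n = (i + (n - k)) % n := by rw [min_eq_left (by omega)]
    have e2 : (min (i + 1) n + (n - k)) % n = ((i + (n - k)) % n + 1) % n := by
      rw [min_eq_left (by omega), Nat.mod_add_mod]
      congr 1; omega
    show ({cgQ _, cgQ _} : Finset Pt2) = _
    rw [e1, e2]
  have hrot : ∀ j, j < n → ((j + k) % n + (n - k)) % n = j := by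
    intro j hj
    rw [Nat.mod_add_mod, show j + k + (n - k) = j + n by omega, Nat.add_mod_right,
      Nat.mod_eq_of_lt hj]
  refine ⟨?_, ?_, ?_, ?_⟩
  · show cgQ _ = cgQ _
    congr 1
    show (min n n + (n - k)) % n = (min 0 n + (n - k)) % n
    rw [min_self, Nat.zero_min, Nat.zero_add, Nat.add_mod_left]
  · intro i hi
    rw [hedge i hi]
    exact cg_edge_bedge hn hn5 (Nat.mod_lt _ (by omega))
  · intro e he
    obtain ⟨j, hj, rfl⟩ := cg_bedge_cycle hn hn5 he
    have hlt := Nat.mod_lt (j + k) (show 0 < n by omega)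
    refine ⟨(j + k) % n, hlt, ?_⟩
    rw [hedge _ hlt, hrot j hj]
  · rintro v ⟨hv, -⟩
    obtain ⟨j, hj, rfl⟩ := cg_mem_verts.1 hv
    have hlt := Nat.mod_lt (j + k) (show 0 < n by omega)
    refine ⟨(j + k) % n, hlt.le, ?_⟩
    show cgQ _ = cgQ _
    rw [min_eq_left hlt.le, hrot j hj]

theorem cg_fan_exists {K : SC V} (hK : K.IsCAT0) {α : EPath K.adj} (hc : α.Closed) {n : ℕ}
    (hlen : α.len = n) (hn : 3 ≤ n) (hn5 : n ≤ 5) {k : ℕ} (hk : k < n)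
    (hapex : ∀ i, i < n → i ≠ k → K.adj (α.f k) (α.f i)) :
    ∃ S : SpanningDisk K α, S.D = cgDisk n hn hn5 := by
  have hfm : ∀ j, j < 5 → α.f ((cgIdx (cgQ j) + k) % n) = α.f ((j + k) % n) := by
    intro j hj; rw [cgIdx_Q hj]
  have hap : ∀ i, 1 ≤ i → i < n → K.adj (α.f ((0 + k) % n)) (α.f ((i + k) % n)) := by
    intro i h1 h2
    rw [Nat.zero_add, Nat.mod_eq_of_lt hk]
    refine hapex _ (Nat.mod_lt _ (by omega)) ?_
    have hcase : n = 3 ∨ n = 4 ∨ n = 5 := by omega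
    rcases hcase with rfl | rfl | rfl <;> omega
  refine ⟨{ D := cgDisk n hn hn5
            fmap := fun p => α.f ((cgIdx p + k) % n)
            cellmap := ?_
            bc := cgBC n hn hn5 k
            bc_is := cg_bc_is n hn hn5 k hk
            bc_len := hlen.symm
            bc_map := ?_ }, rfl⟩
  · intro s hs
    rw [cg_cells_eq] at hs
    obtain ⟨i, i1, i2, i3⟩ := cg_cell_T hn hs
    have hne : s.Nonempty := by
      unfold cgCells at hs
      simp only [Finset.mem_union, Finset.mem_image] at hs
      rcases hs with (⟨v, hv, rfl⟩ | h) | h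
      · simp
      · rcases cg_mem_edges.1 h with ⟨i, hi, rfl⟩ | ⟨i, h1, h2, rfl⟩ <;> simp
      · obtain ⟨i, h1, h2, rfl⟩ := cg_mem_faces.1 h
        simp [cgT]
    have hT : (cgT i).image (fun p => α.f ((cgIdx p + k) % n)) ∈ K.faces := by
      have e : (cgT i).image (fun p => α.f ((cgIdx p + k) % n)) =
          {α.f ((0 + k) % n), α.f ((i + k) % n), α.f ((i + 1 + k) % n)} := by
        unfold cgT
        rw [Finset.image_insert, Finset.image_insert, Finset.image_singleton, hfm 0 (by omega),
          hfm i (by omega), hfm (i + 1) (by omega)]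
      rw [e]
      refine cg_triangle hK (hap i i1 (by omega)) ?_ (hap (i + 1) (by omega) (by omega))
      have := cg_step_mod hc (by omega) (i + k)
      rw [hlen, show i + k + 1 = i + 1 + k by omega] at this
      exact this
    refine K.down _ hT _ (Finset.image_subset_image i3) ?_
    exact (hne.image _).ne_empty
  · intro i
    show α.f ((cgIdx (cgQ ((min i n + (n - k)) % n)) + k) % n) = α.f i
    rw [hfm _ (lt_of_lt_of_le (Nat.mod_lt _ (by omega)) hn5), Nat.mod_add_mod,
      show min i n + (n - k) + k = min i n + n by omega, Nat.add_mod_right]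
    have h1 := cg_per hc (i := min i n) (by rw [hlen]; exact min_le_right _ _)
    rw [hlen] at h1
    rw [h1]
    rcases le_total i n with h | h
    · rw [min_eq_left h]
    · rw [min_eq_right h, α.stable i (by omega), hlen]

theorem cg_area_fan (n : ℕ) (hn : 3 ≤ n) (hn5 : n ≤ 5) : (cgDisk n hn hn5).area ≤ n - 2 := by
  show (cgFaces n).card ≤ n - 2
  unfold cgFaces
  refine Finset.card_image_le.trans ?_
  rw [Nat.card_Ico]
  omega

theorem cg_dist2 {K : SC V} {α : EPath K.adj} (ht : α.Tight) {i : ℕ} (hi : i + 1 < α.len) :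
    α.f i ≠ α.f (i + 2) := by
  intro h
  have := ht i (i + 1) (by omega) hi (by rw [h, Finset.pair_comm])
  omega

/-- The vertices of a short tight loop are distinct. -/
theorem cg_distinct {K : SC V} {α : EPath K.adj} (hc : α.Closed) (ht : α.Tight) {n : ℕ}
    (hlen : α.len = n) (hn : 3 ≤ n) (hn5 : n ≤ 5) :
    ∀ i j, i < n → j < n → α.f i = α.f j → i = j := by
  have hcl : α.f n = α.f 0 := by rw [← hlen]; exact hc
  have h1 : ∀ i, i + 1 < n → α.f i ≠ α.f (i + 1) := fun i hi => (α.step i (by omega)).1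
  have h2 : ∀ i, i + 2 < n → α.f i ≠ α.f (i + 2) := fun i hi => cg_dist2 ht (by omega)
  have h3 : ∀ i, i + 3 < n → α.f i ≠ α.f (i + 3) := by
    intro i hi
    by_cases h4 : n = 4
    · have e : i = 0 := by omega
      subst e h4
      rw [← hcl]
      exact (α.step 3 (by omega)).1.symm
    · have h5 : n = 5 := by omega
      subst h5
      have e : i = 0 ∨ i = 1 := by omega
      rcases e with rfl | rfl
      · rw [← hcl]; exact (cg_dist2 ht (i := 3) (by omega)).symm
      · intro h
        have := ht 0 4 (by omega) (by omega) (by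
          show ({α.f 0, α.f 1} : Finset V) = {α.f 4, α.f 5}
          rw [hcl, h, Finset.pair_comm])
        omega
  have h4 : ∀ i, i + 4 < n → α.f i ≠ α.f (i + 4) := by
    intro i hi
    have h5 : n = 5 := by omega
    have e : i = 0 := by omega
    subst e h5
    rw [← hcl]
    exact (α.step 4 (by omega)).1.symm
  have hlt : ∀ i j, i < j → j < n → α.f i ≠ α.f j := by
    intro i j hij hj
    have e : j = i + 1 ∨ j = i + 2 ∨ j = i + 3 ∨ j = i + 4 := by omega
    rcases e with rfl | rfl | rfl | rfl
    · exact h1 i hj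
    · exact h2 i hj
    · exact h3 i hj
    · exact h4 i hj
  intro i j hi hj h
  by_contra hne
  rcases Nat.lt_or_gt_of_ne hne with h' | h'
  · exact hlt i j h' hj h
  · exact hlt j i h' hi h.symm

/-- In a tight short loop, some vertex is adjacent to all the other vertices of the loop. -/
theorem cg_apex {K : SC V} (h3 : K.Is3Dim) (hK : K.IsCAT0) {α : EPath K.adj} (hc : α.Closed)
    (ht : α.Tight) {n : ℕ} (hlen : α.len = n) (hn : 3 ≤ n) (hn5 : n ≤ 5) :
    ∃ k, k < n ∧ ∀ i, i < n → i ≠ k → K.adj (α.f k) (α.f i) := by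
  have hcl : α.f n = α.f 0 := by rw [← hlen]; exact hc
  have hd := cg_distinct hc ht hlen hn hn5
  have hne : ∀ i j, i < n → j < n → i ≠ j → α.f i ≠ α.f j := fun i j hi hj h h' => h (hd i j hi hj h')
  have hs : ∀ i, i < n → K.adj (α.f i) (α.f (i + 1)) := fun i hi => α.step i (by omega)
  have hcase : n = 3 ∨ n = 4 ∨ n = 5 := by omega
  rcases hcase with rfl | rfl | rfl
  · have s0 := hs 0 (by omega)
    have s1 := hs 1 (by omega)
    have s2 := hs 2 (by omega)
    norm_num at s0 s1 s2
    rw [hcl] at s2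
    refine ⟨0, by omega, ?_⟩
    intro i hi h0
    interval_cases i
    · exact absurd rfl h0
    · exact s0
    · exact cg_adj_symm s2
  · have s0 := hs 0 (by omega)
    have s1 := hs 1 (by omega)
    have s2 := hs 2 (by omega)
    have s3 := hs 3 (by omega)
    norm_num at s0 s1 s2 s3
    rw [hcl] at s3
    have y0 := cg_adj_symm s0
    have y1 := cg_adj_symm s1
    have y2 := cg_adj_symm s2
    have y3 := cg_adj_symm s3
    rcases cg_square h3 hK s0 s1 s2 s3 (hne 0 2 (by omega) (by omega) (by omega))
      (hne 1 3 (by omega) (by omega) (by omega)) with h | h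
    · refine ⟨0, by omega, ?_⟩
      intro i hi h0
      interval_cases i <;> first | exact absurd rfl h0 | assumption
    · refine ⟨1, by omega, ?_⟩
      intro i hi h0
      interval_cases i <;> first | exact absurd rfl h0 | assumption
  · have s0 := hs 0 (by omega)
    have s1 := hs 1 (by omega)
    have s2 := hs 2 (by omega)
    have s3 := hs 3 (by omega)
    have s4 := hs 4 (by omega)
    norm_num at s0 s1 s2 s3 s4
    rw [hcl] at s4
    have y0 := cg_adj_symm s0
    have y1 := cg_adj_symm s1
    have y2 := cg_adj_symm s2
    have y3 := cg_adj_symm s3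
    have y4 := cg_adj_symm s4
    have n02 := hne 0 2 (by omega) (by omega) (by omega)
    have n13 := hne 1 3 (by omega) (by omega) (by omega)
    have n24 := hne 2 4 (by omega) (by omega) (by omega)
    have n30 := hne 3 0 (by omega) (by omega) (by omega)
    have n41 := hne 4 1 (by omega) (by omega) (by omega)
    have key : ∃ k, k < 5 ∧ K.adj (α.f k) (α.f ((k + 2) % 5)) ∧ K.adj (α.f k) (α.f ((k + 3) % 5)) := by
      rcases cg_pentagon h3 hK s0 s1 s2 s3 s4 n02 n13 n24 n30 n41 with h | h | h | h | h
      · rcases cg_square h3 hK h s2 s3 s4 n30.symm n24 with h' | h'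
        · exact ⟨0, by omega, h, h'⟩
        · exact ⟨2, by omega, h', cg_adj_symm h⟩
      · rcases cg_square h3 hK h s3 s4 s0 n41.symm n30 with h' | h'
        · exact ⟨1, by omega, h, h'⟩
        · exact ⟨3, by omega, h', cg_adj_symm h⟩
      · rcases cg_square h3 hK h s4 s0 s1 n02.symm n41 with h' | h'
        · exact ⟨2, by omega, h, h'⟩
        · exact ⟨4, by omega, h', cg_adj_symm h⟩
      · rcases cg_square h3 hK h s0 s1 s2 n13.symm n02 with h' | h'
        · exact ⟨3, by omega, h, h'⟩
        · exact ⟨0, by omega, h', cg_adj_symm h⟩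
      · rcases cg_square h3 hK h s1 s2 s3 n24.symm n13 with h' | h'
        · exact ⟨4, by omega, h, h'⟩
        · exact ⟨1, by omega, h', cg_adj_symm h⟩
    obtain ⟨k, hk, k1, k2⟩ := key
    refine ⟨k, hk, ?_⟩
    intro i hi h0
    interval_cases k <;> norm_num at k1 k2 <;>
      interval_cases i <;> first | exact absurd rfl h0 | assumption

theorem cg_shift4 : ∀ S : Finset (Fin 4), 3 ≤ S.card → 4 ≤ (S ∪ S.image (· + 1)).card := by decide

theorem cg_shift5 : ∀ S : Finset (Fin 5), 3 ≤ S.card → 4 ≤ (S ∪ S.image (· + 1)).card := by decide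

/-- The lower bound on the area of a disk spanning a short tight loop. -/
theorem cg_lower {K : SC V} {α : EPath K.adj} (hc : α.Closed) (ht : α.Tight) {n : ℕ}
    (hlen : α.len = n) (hn : 3 ≤ n) (hn5 : n ≤ 5) (S : SpanningDisk K α) : n - 2 ≤ S.D.area := by
  have hd := cg_distinct hc ht hlen hn hn5
  have hbl : S.bc.len = n := S.bc_len.trans hlen
  have hpair : ∀ i, ({S.bc.f i, S.bc.f (i + 1)} : Finset Pt2).image S.fmap =
      {α.f i, α.f (i + 1)} := by
    intro i
    rw [Finset.image_insert, Finset.image_singleton, S.bc_map, S.bc_map]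
  have hface : ∀ i, i < n → ∃ t ∈ S.D.facesD, S.bc.f i ∈ t ∧ S.bc.f (i + 1) ∈ t := by
    intro i hi
    refine cg_edge_in_face S.D S.bc S.bc_is.1 i (by omega) ?_
    intro j hj hji he
    apply hji
    refine ht j i (by omega) (by omega) ?_
    rw [← hpair, ← hpair, he]
  have hinj : ∀ i j, i < n → j < n → S.bc.f i = S.bc.f j → i = j := by
    intro i j hi hj h
    refine hd i j hi hj ?_
    rw [← S.bc_map, ← S.bc_map, h]
  have hbc : S.bc.f n = S.bc.f 0 := by rw [← hbl]; exact S.bc_is.1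
  by_cases h3 : n = 3
  · obtain ⟨t, h, -⟩ := hface 0 (by omega)
    have : 0 < S.D.facesD.card := Finset.card_pos.2 ⟨t, h⟩
    show n - 2 ≤ S.D.facesD.card
    omega
  have hgen : ∀ m : ℕ, n = m + 1 →
      (∀ S : Finset (Fin (m + 1)), 3 ≤ S.card → 4 ≤ (S ∪ S.image (· + 1)).card) →
      n ≤ 2 * S.D.facesD.card := by
    intro m hm hsh
    subst hm
    have hface' : ∀ i : Fin (m + 1), ∃ t ∈ S.D.facesD, S.bc.f i ∈ t ∧ S.bc.f (i + 1 : Fin (m + 1)) ∈ t := by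
      intro i
      obtain ⟨t, h1, h2, h3⟩ := hface i i.2
      refine ⟨t, h1, h2, ?_⟩
      have : S.bc.f (i + 1 : Fin (m + 1)) = S.bc.f (i + 1) := by
        rw [Fin.val_add_one]
        split_ifs with h
        · rw [h, Fin.val_last, hbc]
        · rfl
      rw [this]; exact h3
    choose t t1 t2 t3 using hface'
    have hfib : ∀ a ∈ Finset.univ.image t, (Finset.univ.filter (fun i => t i = a)).card ≤ 2 := by
      intro a ha
      obtain ⟨i0, -, rfl⟩ := Finset.mem_image.1 ha
      by_contra hcon
      have h4 := hsh _ (by omega : 3 ≤ (Finset.univ.filter (fun i => t i = t i0)).card)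
      have h5 : (Finset.univ.filter (fun i => t i = t i0) ∪
          (Finset.univ.filter (fun i => t i = t i0)).image (· + 1)).card ≤ (t i0).card := by
        refine Finset.card_le_card_of_injOn (fun i => S.bc.f i) ?_ ?_
        · intro i hi
          simp only [Finset.coe_union, Set.mem_union, Finset.mem_coe, Finset.mem_filter,
            Finset.mem_univ, true_and, Finset.mem_image] at hi
          rcases hi with h | ⟨j, h, rfl⟩
          · rw [← h]; exact t2 i
          · rw [← h]; exact t3 j
        · intro i _ j _ h
          exact Fin.ext (hinj i j i.2 j.2 h)
      rw [S.D.face_card _ (t1 i0)] at h5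
      omega
    have h6 := Finset.card_le_mul_card_image (f := t) Finset.univ 2 hfib
    have h7 : (Finset.univ.image t).card ≤ S.D.facesD.card := by
      apply Finset.card_le_card
      intro x hx
      obtain ⟨i0, -, rfl⟩ := Finset.mem_image.1 hx
      exact t1 i0
    rw [Finset.card_univ, Fintype.card_fin] at h6
    omega
  show n - 2 ≤ S.D.facesD.card
  have hcase : n = 4 ∨ n = 5 := by omega
  rcases hcase with h | h
  · have := hgen 3 h cg_shift4
    omega
  · have := hgen 4 h cg_shift5
    omega

end Conclusion

/-- A CAT(0) regular simplicial 3-complex contains no empty triangles, no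
empty squares, and no empty pentagons. -/
theorem statement_6 {V : Type*} [DecidableEq V] (K : SC V) (h3 : K.Is3Dim) (hK : K.IsCAT0) :
    ∀ (α : EPath K.adj) (n : ℕ), n = 3 ∨ n = 4 ∨ n = 5 → ¬ K.IsEmptyNgon α n := by
  rintro α n hcase ⟨hc, ht, hlen, hS⟩
  have hn : 3 ≤ n := by omega
  have hn5 : n ≤ 5 := by omega
  obtain ⟨k, hk, hapex⟩ := cg_apex h3 hK hc ht hlen hn hn5
  obtain ⟨S, hSD⟩ := cg_fan_exists hK hc hlen hn hn5 hk hapex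
  obtain ⟨v, hv⟩ := hS S (by
    intro S'
    rw [hSD]
    exact (cg_area_fan n hn hn5).trans (cg_lower hc ht hlen hn hn5 S'))
  rw [hSD] at hv
  exact cg_no_ivert hn hn5 v hv
end

section
/- Every CAT(0) regular simplicial 3-complex is flag. Moreover, in such a complex at most four distinct vertices can be pairwise connected by edges, and any such set of pairwise adjacent vertices spans a simplex. -/
open scoped Classical

section Helpers

/-- The `ℓ²` inner product on finitely supported functions. -/
def ipF {V : Type*} (x y : V →₀ ℝ) : ℝ := x.sum fun v r => r * y v

theorem ipF_eq {V : Type*} (x y : V →₀ ℝ) (F : Finset V) (h : x.support ⊆ F) :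
    ipF x y = ∑ v ∈ F, x v * y v := by
  unfold ipF
  exact Finsupp.sum_of_support_subset x h _ (by simp)

theorem ipF_comm {V : Type*} (x y : V →₀ ℝ) : ipF x y = ipF y x := by
  classical
  rw [ipF_eq x y (x.support ∪ y.support) Finset.subset_union_left,
    ipF_eq y x (x.support ∪ y.support) Finset.subset_union_right]
  exact Finset.sum_congr rfl fun v _ => mul_comm _ _

theorem ipF_add {V : Type*} (x y z : V →₀ ℝ) : ipF (x + y) z = ipF x z + ipF y z := by
  classical
  unfold ipF
  exact Finsupp.sum_add_index' (by simp) (by intros; ring)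

theorem ipF_smul {V : Type*} (x z : V →₀ ℝ) (r : ℝ) : ipF (r • x) z = r * ipF x z := by
  rw [ipF_eq (r • x) z x.support Finsupp.support_smul, ipF_eq x z x.support (Finset.Subset.refl _),
    Finset.mul_sum]
  refine Finset.sum_congr rfl fun v _ => ?_
  simp [mul_assoc]

theorem ipF_self_nonneg {V : Type*} (x : V →₀ ℝ) : 0 ≤ ipF x x := by
  unfold ipF Finsupp.sum
  exact Finset.sum_nonneg fun v _ => mul_self_nonneg _

theorem ipF_definite {V : Type*} (x : V →₀ ℝ) (h : ipF x x = 0) : x = 0 := by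
  unfold ipF Finsupp.sum at h
  rw [Finset.sum_eq_zero_iff_of_nonneg (fun v _ => mul_self_nonneg _)] at h
  ext v
  by_contra hv
  have := h v (Finsupp.mem_support_iff.mpr hv)
  exact hv (by simpa using this)

/-- The inner product space core structure. -/
def coreF (V : Type*) : InnerProductSpace.Core ℝ (V →₀ ℝ) where
  inner := ipF
  conj_inner_symm x y := by simpa using ipF_comm y x
  re_inner_nonneg x := by simpa using ipF_self_nonneg x
  add_left := ipF_add
  smul_left x y r := by simpa using ipF_smul x y r
  definite := ipF_definite

theorem stepD_eq {V : Type*} (x y : V →₀ ℝ) : stepD x y = Real.sqrt (ipF (x - y) (x - y) / 2) := by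
  unfold stepD ipF
  simp only [pow_two]
  rfl

theorem stepD_sq {V : Type*} (x y : V →₀ ℝ) : stepD x y ^ 2 = ipF (x - y) (x - y) / 2 := by
  rw [stepD_eq, Real.sq_sqrt]
  have := ipF_self_nonneg (x - y)
  positivity

theorem stepD_nonneg {V : Type*} (x y : V →₀ ℝ) : 0 ≤ stepD x y := Real.sqrt_nonneg _

theorem stepD_triangle {V : Type*} (x y z : V →₀ ℝ) : stepD x z ≤ stepD x y + stepD y z := by
  letI := (coreF V).toNormedAddCommGroup
  have key : ∀ a b : V →₀ ℝ, stepD a b = ‖a - b‖ / Real.sqrt 2 := by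
    intro a b
    rw [stepD_eq, Real.sqrt_div (ipF_self_nonneg _)]
    rfl
  rw [key, key, key, ← add_div]
  gcongr
  exact norm_sub_le_norm_sub_add_norm_sub x y z

/-- Parallelogram identity around a midpoint. -/
theorem ipF_median {V : Type*} (x y z : V →₀ ℝ) :
    ipF (x - (1 / 2 : ℝ) • (y + z)) (x - (1 / 2 : ℝ) • (y + z)) =
      ipF (x - y) (x - y) / 2 + ipF (x - z) (x - z) / 2 - ipF (y - z) (y - z) / 4 := by
  have hr : ∀ a b c : V →₀ ℝ, ipF a (b + c) = ipF a b + ipF a c := fun a b c => by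
    rw [ipF_comm, ipF_add, ipF_comm b, ipF_comm c]
  have hs : ∀ (a b : V →₀ ℝ) (r : ℝ), ipF a (r • b) = r * ipF a b := fun a b r => by
    rw [ipF_comm, ipF_smul, ipF_comm b]
  have hneg : ∀ a b : V →₀ ℝ, a - b = a + (-1 : ℝ) • b := fun a b => by
    rw [neg_one_smul, sub_eq_add_neg]
  simp only [hneg, ipF_add, ipF_smul, hr, hs]
  rw [ipF_comm y x, ipF_comm z x, ipF_comm z y]
  ring

theorem stepD_median {V : Type*} (x y z : V →₀ ℝ) :
    stepD x ((1 / 2 : ℝ) • (y + z)) ^ 2 =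
      stepD x y ^ 2 / 2 + stepD x z ^ 2 / 2 - stepD y z ^ 2 / 4 := by
  simp only [stepD_sq, ipF_median]
  ring

theorem stepD_comm {V : Type*} (x y : V →₀ ℝ) : stepD x y = stepD y x := by
  have h : stepD x y ^ 2 = stepD y x ^ 2 := by
    have e : x - y = (-1 : ℝ) • (y - x) := by rw [neg_one_smul, neg_sub]
    rw [stepD_sq, stepD_sq, e, ipF_smul, ipF_comm, ipF_smul]
    ring
  exact (sq_eq_sq₀ (stepD_nonneg _ _) (stepD_nonneg _ _)).mp h

theorem stepD_self {V : Type*} (x : V →₀ ℝ) : stepD x x = 0 := by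
  simp [stepD]

theorem stepD_mid_left {V : Type*} (y z : V →₀ ℝ) :
    stepD y ((1 / 2 : ℝ) • (y + z)) = stepD y z / 2 := by
  have h := stepD_median y y z
  rw [stepD_self] at h
  refine (sq_eq_sq₀ (stepD_nonneg _ _) (by have := stepD_nonneg y z; positivity)).mp ?_
  rw [h]; ring

theorem stepD_mid_right {V : Type*} (y z : V →₀ ℝ) :
    stepD ((1 / 2 : ℝ) • (y + z)) z = stepD y z / 2 := by
  rw [stepD_comm, add_comm, stepD_mid_left, stepD_comm]

/-- Uniqueness of midpoints. -/
theorem stepD_mid_unique {V : Type*} (x y q : V →₀ ℝ) (h1 : stepD x q ≤ stepD x y / 2)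
    (h2 : stepD q y ≤ stepD x y / 2) : q = (1 / 2 : ℝ) • (x + y) := by
  have h := stepD_median q x y
  rw [stepD_comm q x] at h
  have hx := stepD_nonneg x q
  have hy := stepD_nonneg q y
  have h0 : stepD q ((1 / 2 : ℝ) • (x + y)) ^ 2 = 0 := by
    refine le_antisymm ?_ (sq_nonneg _)
    rw [h]
    nlinarith
  rw [stepD_sq] at h0
  exact sub_eq_zero.mp (ipF_definite _ (by linarith))

theorem stepD_le_chLen {V : Type*} (c : List (V →₀ ℝ)) : ∀ x y : V →₀ ℝ, c.head? = some x →
    c.getLast? = some y → stepD x y ≤ chLen c := by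
  induction c with
  | nil => intro x y h; simp at h
  | cons a l ih =>
    intro x y hx hy
    simp only [List.head?_cons, Option.some.injEq] at hx
    subst hx
    cases l with
    | nil =>
      simp only [List.getLast?_singleton, Option.some.injEq] at hy
      subst hy
      simp [chLen, stepD_self]
    | cons b l =>
      have h := ih b y rfl (by simpa [List.getLast?_cons_cons] using hy)
      have h2 : chLen (a :: b :: l) = stepD a b + chLen (b :: l) := by
        simp [chLen]
      rw [h2]
      linarith [stepD_triangle a b y]

variable {V : Type*} [DecidableEq V]

theorem stepD_le_pdist (K : SC V) (hK : K.IsCAT0) (x y : V →₀ ℝ) (hx : K.IsPoint x)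
    (hy : K.IsPoint y) : stepD x y ≤ K.pdist x y := by
  obtain ⟨c, h1, h2, h3⟩ := hK.2.1 x y hx hy
  refine le_csInf ⟨_, c, h1, h2, h3, rfl⟩ ?_
  rintro L ⟨c, -, h2, h3, rfl⟩
  exact stepD_le_chLen c x y h2 h3

theorem pdist_eq (K : SC V) (hK : K.IsCAT0) (x y : V →₀ ℝ) (hx : K.IsPoint x)
    (hy : K.IsPoint y) (hxy : K.SameCell x y) : K.pdist x y = stepD x y := by
  refine le_antisymm (csInf_le ⟨stepD x y, ?_⟩ ⟨[x, y], ⟨?_, ?_⟩, rfl, rfl, ?_⟩)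
    (stepD_le_pdist K hK x y hx hy)
  · rintro L ⟨c, -, h2, h3, rfl⟩
    exact stepD_le_chLen c x y h2 h3
  · simp [hx, hy]
  · exact List.isChain_pair.mpr hxy
  · simp [chLen]

/-- Nonnegative coordinates of total mass one. -/
def IsProb (x : V →₀ ℝ) : Prop := (∀ v, 0 ≤ x v) ∧ (x.sum fun _ r => r) = 1

theorem exists_prob (t : Finset V) (ht : t.Nonempty) : ∃ x : V →₀ ℝ, IsProb x ∧ x.support = t := by
  have hc : (0 : ℝ) < t.card := by exact_mod_cast ht.card_pos
  let x : V →₀ ℝ := Finsupp.onFinset t (fun v => if v ∈ t then (t.card : ℝ)⁻¹ else 0)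
    (by intro v hv; by_contra h; simp [h] at hv)
  have hs : x.support = t := by
    ext v
    simp [x, hc.ne']
  refine ⟨x, ⟨fun v => ?_, ?_⟩, hs⟩
  · simp only [x, Finsupp.onFinset_apply]
    split_ifs <;> positivity
  · rw [Finsupp.sum, hs]
    have : ∀ v ∈ t, x v = (t.card : ℝ)⁻¹ := fun v hv => by simp [x, hv]
    rw [Finset.sum_congr rfl this]
    simp [hc.ne']

theorem IsProb.mid {x y : V →₀ ℝ} (hx : IsProb x) (hy : IsProb y) :
    IsProb ((1 / 2 : ℝ) • (x + y)) ∧ ((1 / 2 : ℝ) • (x + y)).support = x.support ∪ y.support := by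
  refine ⟨⟨fun v => ?_, ?_⟩, ?_⟩
  · have := hx.1 v
    have := hy.1 v
    simp only [Finsupp.smul_apply, Finsupp.add_apply, smul_eq_mul]
    positivity
  · rw [Finsupp.sum_smul_index' (by simp)]
    simp only [smul_eq_mul]
    rw [← Finsupp.mul_sum, Finsupp.sum_add_index' (by simp) (by simp), hx.2, hy.2]
    norm_num
  · ext v
    have h1 := hx.1 v
    have h2 := hy.1 v
    simp only [Finsupp.mem_support_iff, Finsupp.smul_apply, Finsupp.add_apply, smul_eq_mul,
      Finset.mem_union]
    constructor
    · intro h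
      by_contra! h'
      simp [h'.1, h'.2] at h
    · rintro (h | h)
      · have : 0 < x v := lt_of_le_of_ne h1 (Ne.symm h)
        positivity
      · have : 0 < y v := lt_of_le_of_ne h2 (Ne.symm h)
        positivity

/-- Three finite vertex sets with pairwise unions simplices have their union a simplex. -/
theorem join_three (K : SC V) (hK : K.IsCAT0) (A B C : Finset V) (hA : A.Nonempty)
    (hB : B.Nonempty) (hC : C.Nonempty) (hAB : A ∪ B ∈ K.faces) (hAC : A ∪ C ∈ K.faces)
    (hBC : B ∪ C ∈ K.faces) : A ∪ (B ∪ C) ∈ K.faces := by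
  obtain ⟨a, ha, rfl⟩ := exists_prob A hA
  obtain ⟨b, hb, rfl⟩ := exists_prob B hB
  obtain ⟨c, hc, rfl⟩ := exists_prob C hC
  have pa : K.IsPoint a := ⟨ha.1, ha.2, K.down _ hAB _ Finset.subset_union_left hA.ne_empty⟩
  have pb : K.IsPoint b := ⟨hb.1, hb.2, K.down _ hBC _ Finset.subset_union_left hB.ne_empty⟩
  have pc : K.IsPoint c := ⟨hc.1, hc.2, K.down _ hBC _ Finset.subset_union_right hC.ne_empty⟩
  obtain ⟨hm, hms⟩ := hb.mid hc
  have h1 := stepD_mid_left b c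
  have h2 := stepD_mid_right b c
  have h3 := stepD_median a b c
  set m := (1 / 2 : ℝ) • (b + c) with hmdef
  have pm : K.IsPoint m := ⟨hm.1, hm.2, by rw [hms]; exact hBC⟩
  have cab : K.pdist a b = stepD a b := pdist_eq K hK a b pa pb (by unfold SC.SameCell; convert hAB)
  have cac : K.pdist a c = stepD a c := pdist_eq K hK a c pa pc (by unfold SC.SameCell; convert hAC)
  have cbc : K.pdist b c = stepD b c := pdist_eq K hK b c pb pc (by unfold SC.SameCell; convert hBC)
  have cbm : K.pdist b m = stepD b m := pdist_eq K hK b m pb pm (by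
    unfold SC.SameCell
    rw [hms, ← Finset.union_assoc, Finset.union_self]
    exact hBC)
  have cmc : K.pdist m c = stepD m c := pdist_eq K hK m c pm pc (by
    unfold SC.SameCell
    rw [hms, Finset.union_assoc, Finset.union_self]
    exact hBC)
  have cn := hK.2.2.2 a b c m pa pb pc pm (by rw [cbm, cbc, h1]) (by rw [cmc, cbc, h2])
  rw [cab, cac, cbc, ← h3] at cn
  have hle : K.pdist a m ≤ stepD a m := le_of_sq_le_sq cn (stepD_nonneg _ _)
  obtain ⟨q, pq, hq1, hq2⟩ := hK.2.2.1 a m pa pm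
  have e1 := stepD_le_pdist K hK a q pa pq
  have e2 := stepD_le_pdist K hK q m pq pm
  have hq := stepD_mid_unique a m q (by linarith) (by linarith)
  have hs := (ha.mid hm).2
  rw [← hq, hms] at hs
  have := pq.2.2
  rw [hs] at this
  exact this

theorem flag_aux (K : SC V) (hK : K.IsCAT0) : ∀ (n : ℕ) (s : Finset V), s.card = n → s.Nonempty →
    (∀ v ∈ s, ({v} : Finset V) ∈ K.faces) →
    (∀ u ∈ s, ∀ w ∈ s, u ≠ w → ({u, w} : Finset V) ∈ K.faces) → s ∈ K.faces := by
  intro n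
  induction n using Nat.strong_induction_on with
  | _ n ih =>
    intro s hn hs h1 h2
    have sub : ∀ t : Finset V, t ⊂ s → t.Nonempty → t ∈ K.faces := fun t ht hne =>
      ih t.card (hn ▸ Finset.card_lt_card ht) t rfl hne (fun v hv => h1 v (ht.1 hv))
        (fun u hu w hw => h2 u (ht.1 hu) w (ht.1 hw))
    obtain ⟨a, ha⟩ := hs
    by_cases hA : (s.erase a).Nonempty
    · obtain ⟨b, hb⟩ := hA
      by_cases hB : ((s.erase a).erase b).Nonempty
      · have eb := Finset.insert_erase hb
        have ea := Finset.insert_erase ha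
        have hab : a ≠ b := fun h => by simp [h] at hb
        have hbs : b ∈ s := Finset.mem_of_mem_erase hb
        have key := join_three K hK {a} {b} ((s.erase a).erase b) (by simp) (by simp) hB
          (by
            have := h2 a ha b hbs hab
            rwa [Finset.insert_eq] at this)
          (by
            rw [← Finset.insert_eq, Finset.erase_right_comm, Finset.insert_erase]
            · exact sub _ (Finset.erase_ssubset hbs) ⟨a, by simp [ha, hab]⟩
            · simp [ha, hab])
          (by
            rw [← Finset.insert_eq, eb]
            exact sub _ (Finset.erase_ssubset ha) ⟨b, hb⟩)
        rwa [← Finset.insert_eq, ← Finset.insert_eq, eb, ea] at key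
      · rw [Finset.not_nonempty_iff_eq_empty] at hB
        have eb := Finset.insert_erase hb
        have ea := Finset.insert_erase ha
        rw [hB] at eb
        rw [← eb] at ea
        have hab : a ≠ b := fun h => by simp [h] at hb
        have := h2 a ha b (Finset.mem_of_mem_erase hb) hab
        rw [← ea]
        exact this
    · rw [Finset.not_nonempty_iff_eq_empty] at hA
      have ea := Finset.insert_erase ha
      rw [hA] at ea
      rw [← ea]
      exact h1 a ha

end Helpers

/-- Every CAT(0) regular simplicial 3-complex is flag.  Moreover, in such a
complex at most four distinct vertices can be pairwise connected by edges, and any set of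
pairwise adjacent vertices spans a simplex. -/
theorem statement_8 {V : Type*} [DecidableEq V] (K : SC V) (h3 : K.Is3Dim) (hK : K.IsCAT0) :
    K.IsFlag ∧
      ∀ s : Finset V, s.Nonempty → (∀ v ∈ s, ({v} : Finset V) ∈ K.faces) →
        (∀ u ∈ s, ∀ w ∈ s, u ≠ w → ({u, w} : Finset V) ∈ K.faces) →
          s ∈ K.faces ∧ s.card ≤ 4 := by
  have H : K.IsFlag := fun s hs h1 h2 => flag_aux K hK s.card s rfl hs h1 h2
  exact ⟨H, fun s hs h1 h2 => ⟨H s hs h1 h2, h3 s (H s hs h1 h2)⟩⟩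
end
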